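/- Let k be an infinite cardinal and let X be an absolute F_σδ-set such that Ind X = 0, X is nowhere σLW(<k) + 𝒢_δσ, X contains a dense topologically complete subspace, and the weight of X equals k. Then X is homeomorphic to M^{II}_k, i.e., to the complement B*(k) ∖ Y of a dense subset Y of B*(k) homeomorphic to A^I_k. -/

import Mathlib

open Topology Set Filter

universe u v

noncomputable section

/-- Strong zero-dimensionality (`Ind X = 0`): any two disjoint closed sets
can be separated by a clopen set. -/
def StronglyZeroDim (X : Type*) [TopologicalSpace X] : Prop :=
  ∀ A B : Set X, IsClosed A → IsClosed B → Disjoint A B →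
    ∃ U : Set X, IsClopen U ∧ A ⊆ U ∧ Disjoint B U

/-- The topological weight of a space: the least cardinality of a base. -/
def topWeight (X : Type u) [TopologicalSpace X] : Cardinal.{u} :=
  ⨅ B : {B : Set (Set X) // TopologicalSpace.IsTopologicalBasis B}, Cardinal.mk B.1

/-- The space has a base of cardinality `< k`. -/
def WeightLT (X : Type u) [TopologicalSpace X] (k : Cardinal.{u}) : Prop :=
  ∃ B : Set (Set X), TopologicalSpace.IsTopologicalBasis B ∧ Cardinal.mk B < k

/-- Every point has a neighborhood of weight `< k`. -/
def LocallyWeightLT (X : Type u) [TopologicalSpace X] (k : Cardinal.{u}) : Prop :=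
  ∀ x : X, ∃ s : Set X, s ∈ nhds x ∧ WeightLT ↥s k

/-- `X ∈ σLW(<k)`: `X` is a countable union of subspaces, each locally of weight `< k`. -/
def SigmaLW (X : Type u) [TopologicalSpace X] (k : Cardinal.{u}) : Prop :=
  ∃ S : ℕ → Set X, (⋃ n, S n) = Set.univ ∧ ∀ n, LocallyWeightLT ↥(S n) k

/-- A `G_δσ`-subset: a countable union of `G_δ`-sets. -/
def IsGdeltaSigma {Y : Type*} [TopologicalSpace Y] (s : Set Y) : Prop :=
  ∃ G : ℕ → Set Y, (∀ n, IsGδ (G n)) ∧ s = ⋃ n, G n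

/-- An `F_σ`-subset: a countable union of closed sets. -/
def IsFsigmaSet {Y : Type*} [TopologicalSpace Y] (s : Set Y) : Prop :=
  ∃ F : ℕ → Set Y, (∀ n, IsClosed (F n)) ∧ s = ⋃ n, F n

/-- An `F_σδ`-subset: a countable intersection of `F_σ`-sets. -/
def IsFsigmaDelta {Y : Type*} [TopologicalSpace Y] (s : Set Y) : Prop :=
  ∃ F : ℕ → Set Y, (∀ n, IsFsigmaSet (F n)) ∧ s = ⋂ n, F n

/-- An absolute `G_δσ`-set: a metrizable space whose image under every embedding
into a metrizable space is a countable union of `G_δ`-sets. -/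
def AbsGdeltaSigma (X : Type u) [TopologicalSpace X] : Prop :=
  TopologicalSpace.MetrizableSpace X ∧
    ∀ (Y : Type u) [TopologicalSpace Y] [TopologicalSpace.MetrizableSpace Y]
      (f : X → Y), Topology.IsEmbedding f → IsGdeltaSigma (Set.range f)

/-- An absolute `F_σδ`-set: a metrizable space whose image under every embedding
into a metrizable space is an `F_σδ`-set. -/
def AbsFsigmaDelta (X : Type u) [TopologicalSpace X] : Prop :=
  TopologicalSpace.MetrizableSpace X ∧
    ∀ (Y : Type u) [TopologicalSpace Y] [TopologicalSpace.MetrizableSpace Y]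
      (f : X → Y), Topology.IsEmbedding f → IsFsigmaDelta (Set.range f)

/-- `X ∈ σLW(<k) + 𝒢_δσ` : `X = A ∪ B` with `A ∈ σLW(<k)` and `B` an absolute
`G_δσ`-set. -/
def SLWplusGDS (X : Type u) [TopologicalSpace X] (k : Cardinal.{u}) : Prop :=
  ∃ A B : Set X, A ∪ B = Set.univ ∧ SigmaLW ↥A k ∧ AbsGdeltaSigma ↥B

/-- No nonempty open subspace is `σLW(<k) + 𝒢_δσ`. -/
def NowhereSLWplusGDS (X : Type u) [TopologicalSpace X] (k : Cardinal.{u}) : Prop :=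
  ∀ U : Set X, IsOpen U → U.Nonempty → ¬ SLWplusGDS ↥U k

/-- A space is of first category if it is meager in itself. -/
def FirstCategory (X : Type*) [TopologicalSpace X] : Prop :=
  IsMeagre (Set.univ : Set X)

/-- A Souslin (analytic) subset of a space:
`s = ⋃_{t ∈ ω^ω} ⋂_n F(t↾n)` for a family of closed sets indexed by finite tuples. -/
def IsSuslinIn {Y : Type*} [TopologicalSpace Y] (s : Set Y) : Prop :=
  ∃ F : List ℕ → Set Y, (∀ l, IsClosed (F l)) ∧
    s = ⋃ t : ℕ → ℕ, ⋂ n : ℕ, F (List.ofFn fun i : Fin n => t i)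

/-- An absolute Souslin space: metrizable, and Souslin in every completely metrizable
space into which it embeds. -/
def AbsSuslin (X : Type u) [TopologicalSpace X] : Prop :=
  TopologicalSpace.MetrizableSpace X ∧
    ∀ (Y : Type u) [MetricSpace Y] [CompleteSpace Y] (f : X → Y),
      Topology.IsEmbedding f → IsSuslinIn (Set.range f)

/-- An h-homogeneous space: every nonempty clopen subset is homeomorphic to the
whole space. -/
def HHomogeneous (X : Type*) [TopologicalSpace X] : Prop :=
  ∀ U : Set X, IsClopen U → U.Nonempty → Nonempty (↥U ≃ₜ X)

/-- A discrete family of sets: every point has a neighborhood meeting at most one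
member of the family. -/
def DiscreteFamily {X : Type*} [TopologicalSpace X] {ι : Type*} (f : ι → Set X) : Prop :=
  ∀ x : X, ∃ U ∈ nhds x, {i | (f i ∩ U).Nonempty}.Subsingleton

/-- A discrete space of cardinality `k`. -/
def DiscT (k : Cardinal.{u}) : Type u := k.out

instance (k : Cardinal.{u}) : TopologicalSpace (DiscT k) := ⊥
instance (k : Cardinal.{u}) : DiscreteTopology (DiscT k) := ⟨rfl⟩

/-- The Baire space `B(k) = k^ω`. -/
def BaireB (k : Cardinal.{u}) : Type u := ℕ → DiscT k

instance (k : Cardinal.{u}) : TopologicalSpace (BaireB k) :=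
  inferInstanceAs (TopologicalSpace (ℕ → DiscT k))

open Classical in
/-- The discrete factor of `B*(k)`: two points if `k = ℵ₀`, and `k` points otherwise. -/
def StarT (k : Cardinal.{u}) : Type u :=
  if k = Cardinal.aleph0 then ULift Bool else DiscT k

instance (k : Cardinal.{u}) : TopologicalSpace (StarT k) := ⊥
instance (k : Cardinal.{u}) : DiscreteTopology (StarT k) := ⟨rfl⟩

/-- `B*(k)`: the Cantor set `2^ω` if `k = ℵ₀`, and the Baire space `B(k)` if `k > ℵ₀`. -/
def BaireStar (k : Cardinal.{u}) : Type u := ℕ → StarT k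

instance (k : Cardinal.{u}) : TopologicalSpace (BaireStar k) :=
  inferInstanceAs (TopologicalSpace (ℕ → StarT k))

/-- A discrete space of cardinality `k` (for infinite `k`), with a distinguished basepoint. -/
def QBase (k : Cardinal.{u}) : Type u := DiscT k ⊕ PUnit.{u + 1}

instance (k : Cardinal.{u}) : TopologicalSpace (QBase k) := ⊥
instance (k : Cardinal.{u}) : DiscreteTopology (QBase k) := ⟨rfl⟩

/-- `Q(k)`: the σ-product of `ω` copies of a discrete space of cardinality `k`, i.e.
the subspace of the product consisting of the sequences eventually equal to the basepoint. -/
def Qk (k : Cardinal.{u}) : Type u :=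
  {x : ℕ → QBase k // ∀ᶠ n in Filter.atTop, x n = Sum.inr PUnit.unit}

instance (k : Cardinal.{u}) : TopologicalSpace (Qk k) :=
  inferInstanceAs (TopologicalSpace
    {x : ℕ → QBase k // ∀ᶠ n in Filter.atTop, x n = Sum.inr PUnit.unit})

/-- The countable power `Q(k)^ω`. -/
def QkOmega (k : Cardinal.{u}) : Type u := ℕ → Qk k

instance (k : Cardinal.{u}) : TopologicalSpace (QkOmega k) :=
  inferInstanceAs (TopologicalSpace (ℕ → Qk k))

/-- `Z` is homeomorphic to `Q(k)^ω`. -/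
def IsQkOmega (k : Cardinal.{u}) (Z : Type*) [TopologicalSpace Z] : Prop :=
  Nonempty (Z ≃ₜ QkOmega k)

/-- `Z` is homeomorphic to `A^{II}_k`, the complement in `B*(k)` of a dense copy of
`Q(k)^ω`. -/
def IsAII (k : Cardinal.{u}) (Z : Type*) [TopologicalSpace Z] : Prop :=
  ∃ A : Set (BaireStar k), Dense A ∧ IsQkOmega k ↥A ∧ Nonempty (Z ≃ₜ ↥(Aᶜ))

/-- `Z` is homeomorphic to `A^I_k = Q × A^{II}_k`. -/
def IsAI (k : Cardinal.{u}) (Z : Type*) [TopologicalSpace Z] : Prop :=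
  ∃ A : Set (BaireStar k), Dense A ∧ IsQkOmega k ↥A ∧ Nonempty (Z ≃ₜ (ℚ × ↥(Aᶜ)))

/-- `Z` is homeomorphic to `M^{II}_k`, the complement in `B*(k)` of a dense copy of
`A^I_k`. -/
def IsMII (k : Cardinal.{u}) (Z : Type*) [TopologicalSpace Z] : Prop :=
  ∃ Y : Set (BaireStar k), Dense Y ∧ IsAI k ↥Y ∧ Nonempty (Z ≃ₜ ↥(Yᶜ))

/-- `X ∈ 𝓕_σδ ∖ σLW(<k)`: `X` is homeomorphic to `F ∖ L` for some absolute
`F_σδ`-space `F` and some `L ⊆ F` with `L ∈ σLW(<k)`. -/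
def FsdMinusSLW (X : Type u) [TopologicalSpace X] (k : Cardinal.{u}) : Prop :=
  ∃ (F : TopCat.{u}) (L : Set F), AbsFsigmaDelta ↥F ∧ SigmaLW ↥L k ∧
    Nonempty (X ≃ₜ ↥(Lᶜ))

/-- No nonempty open subspace is in the class `𝓕_σδ ∖ σLW(<k)`. -/
def NowhereFsdMinusSLW (X : Type u) [TopologicalSpace X] (k : Cardinal.{u}) : Prop :=
  ∀ U : Set X, IsOpen U → U.Nonempty → ¬ FsdMinusSLW ↥U k

/-- A topologically complete (i.e. completely metrizable) space. -/
def CompletelyMetrizable (X : Type*) [t : TopologicalSpace X] : Prop :=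
  ∃ m : MetricSpace X, m.toUniformSpace.toTopologicalSpace = t ∧
    @CompleteSpace X m.toUniformSpace

end

section
namespace MK

/-- general criterion for a `Gδ` range -/
theorem gdelta_gen {D : Type*} {Y : Type*} [TopologicalSpace D] [TopologicalSpace Y]
    [TopologicalSpace.MetrizableSpace Y] (f : D → Y) (hf : IsEmbedding f)
    (small : ℕ → Set D → Prop)
    (h1 : ∀ n x, ∃ V, IsOpen V ∧ x ∈ V ∧ small n V)
    (h2 : ∀ F : Filter D, F.NeBot → (∀ n, ∃ V ∈ F, small n V) → ∃ x, ClusterPt x F) :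
    IsGδ (range f) := by
  let _ := TopologicalSpace.metrizableSpaceMetric Y
  have hG : range f = closure (range f) ∩ ⋂ n : ℕ, ⋃₀ {V | IsOpen V ∧ small n (f ⁻¹' V)} := by
    ext y
    constructor
    · rintro ⟨x, rfl⟩
      refine ⟨subset_closure ⟨x, rfl⟩, mem_iInter.2 fun n => ?_⟩
      obtain ⟨V, hV, hx, hs⟩ := h1 n x
      obtain ⟨W, hW, rfl⟩ := hf.isInducing.isOpen_iff.1 hV
      exact ⟨W, ⟨hW, hs⟩, hx⟩
    · rintro ⟨hc, hy⟩
      have hne : (comap f (𝓝 y)).NeBot := by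
        rw [comap_neBot_iff_frequently]
        have := mem_closure_iff_frequently.1 hc
        exact this
      obtain ⟨x, hx⟩ := h2 (comap f (𝓝 y)) hne (fun n => by
        obtain ⟨V, ⟨hV, hs⟩, hyV⟩ := mem_iInter.1 hy n
        exact ⟨f ⁻¹' V, preimage_mem_comap (hV.mem_nhds hyV), hs⟩)
      refine ⟨x, ?_⟩
      have h3 : ClusterPt (f x) (𝓝 y) := by
        have := hx.map (hf.continuous.tendsto x) tendsto_comap
        exact this
      by_contra hne'
      have : Disjoint (𝓝 (f x)) (𝓝 y) := disjoint_nhds_nhds.2 hne'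
      have h4 : (𝓝 (f x) ⊓ 𝓝 y).NeBot := h3
      exact h4.ne this.eq_bot
  rw [hG]
  refine isClosed_closure.isGδ.inter (IsGδ.iInter_of_isOpen fun n => ?_)
  exact isOpen_sUnion fun V hV => hV.1

theorem gdelta_complete {D : Type*} {Y : Type*} [TopologicalSpace D] [TopologicalSpace Y]
    [TopologicalSpace.MetrizableSpace Y] (hD : CompletelyMetrizable D)
    (f : D → Y) (hf : IsEmbedding f) : IsGδ (range f) := by
  obtain ⟨m, rfl, hm⟩ := hD
  refine gdelta_gen f hf (fun n V => ∀ x ∈ V, ∀ y ∈ V, dist x y < 1 / ((n : ℝ) + 1)) ?_ ?_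
  · intro n x
    refine ⟨Metric.ball x (1 / ((n : ℝ) + 1) / 2), Metric.isOpen_ball,
      Metric.mem_ball_self (by positivity), ?_⟩
    intro a ha b hb
    have := dist_triangle_right a b x
    rw [Metric.mem_ball] at ha hb
    linarith
  · intro F hF h
    have hc : Cauchy F := by
      rw [Metric.cauchy_iff]
      refine ⟨hF, fun ε hε => ?_⟩
      obtain ⟨n, hn⟩ := exists_nat_one_div_lt hε
      obtain ⟨V, hV, hs⟩ := h n
      exact ⟨V, hV, fun x hx y hy => (hs x hx y hy).trans hn⟩
    obtain ⟨x, hx⟩ := CompleteSpace.complete hc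
    exact ⟨x, ClusterPt.of_le_nhds hx⟩

variable {T : Type*} [TopologicalSpace T] [DiscreteTopology T]

theorem isClopen_cyl (x : ℕ → T) (n : ℕ) : IsClopen (PiNat.cylinder x n) := by
  refine ⟨?_, PiNat.isOpen_cylinder _ x n⟩
  have : PiNat.cylinder x n = ⋂ i ∈ Finset.range n, (fun y : ℕ → T => y i) ⁻¹' {x i} := by
    ext y; simp [PiNat.mem_cylinder_iff]
  rw [this]
  exact isClosed_biInter fun i _ => (isClosed_discrete _).preimage (continuous_apply i)

theorem exists_cyl_subset {U : Set (ℕ → T)} (hU : IsOpen U) {x : ℕ → T} (hx : x ∈ U) (N : ℕ) :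
    ∃ n, N ≤ n ∧ PiNat.cylinder x n ⊆ U := by
  obtain ⟨_, ⟨y, n, rfl⟩, hxy, hs⟩ :=
    (PiNat.isTopologicalBasis_cylinders (fun _ => T)).exists_subset_of_mem_open hx hU
  refine ⟨max n N, le_max_right _ _, ?_⟩
  rw [PiNat.mem_cylinder_iff_eq] at hxy
  exact ((PiNat.cylinder_anti x (le_max_left _ _)).trans hxy.le).trans hs

theorem gdelta_cyl {Y : Type*} [TopologicalSpace Y]
    [TopologicalSpace.MetrizableSpace Y] (G : Set (ℕ → T)) (hG : IsGδ G)
    (f : G → Y) (hf : IsEmbedding f) : IsGδ (range f) := by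
  obtain ⟨W, hW, rfl⟩ := isGδ_iff_eq_iInter_nat.1 hG
  refine gdelta_gen f hf (fun n V => ∃ x m, n ≤ m ∧ Subtype.val '' V ⊆ PiNat.cylinder x m ∧
    PiNat.cylinder x m ⊆ W n) ?_ ?_
  · intro n x
    obtain ⟨m, hm, hs⟩ := exists_cyl_subset (hW n) (mem_iInter.1 x.2 n) n
    refine ⟨Subtype.val ⁻¹' PiNat.cylinder x.1 m,
      (isClopen_cyl _ _).isOpen.preimage continuous_subtype_val,
      PiNat.self_mem_cylinder _ _, x.1, m, hm, image_preimage_subset _ _, hs⟩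
  · intro F hF h
    choose V hV x m hm hs hW' using h
    have key : ∀ a b, ∀ i, i < m a → i < m b → x a i = x b i := by
      intro a b i hia hib
      obtain ⟨z, hz⟩ := hF.nonempty_of_mem (inter_mem (hV a) (hV b))
      rw [← hs a ⟨z, hz.1, rfl⟩ i hia, ← hs b ⟨z, hz.2, rfl⟩ i hib]
    have hin : ∀ n, (fun i => x (i + 1) i) ∈ PiNat.cylinder (x n) (m n) := by
      intro n i hi
      exact key _ _ i ((Nat.lt_succ_self i).trans_le (hm (i+1))) hi
    refine ⟨⟨fun i => x (i+1) i, mem_iInter.2 fun n => hW' n (hin n)⟩, ?_⟩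
    refine ClusterPt.of_le_nhds ?_
    intro O hO
    obtain ⟨O', hO', hsub⟩ := mem_nhds_subtype _ _ _ |>.1 hO
    obtain ⟨n, -, hn⟩ := exists_cyl_subset isOpen_interior (mem_interior_iff_mem_nhds.2 hO') 0
    refine mem_of_superset (hV n) fun z hz => hsub ?_
    have hz1 : z.1 ∈ interior O' := hn ?_
    · exact (interior_subset : interior O' ⊆ O') hz1
    have h1 := hs n ⟨z, hz, rfl⟩
    have h2 := hin n
    intro i hi
    have hi' := hi.trans_le (hm n)
    exact (h1 i hi').trans (h2 i hi').symm

section weight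

theorem weightLT_of_inducing {Z W : Type u} [TopologicalSpace Z] [TopologicalSpace W]
    {k : Cardinal.{u}} {f : Z → W} (hf : IsInducing f) (h : WeightLT W k) : WeightLT Z k := by
  obtain ⟨B, hB, hc⟩ := h
  exact ⟨_, hB.isInducing hf, Cardinal.mk_image_le.trans_lt hc⟩

theorem lw_of_inducing {Z W : Type u} [TopologicalSpace Z] [TopologicalSpace W]
    {k : Cardinal.{u}} {f : Z → W} (hf : IsInducing f) (h : LocallyWeightLT W k) :
    LocallyWeightLT Z k := by
  intro z
  obtain ⟨s, hs, hw⟩ := h (f z)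
  refine ⟨f ⁻¹' s, hf.continuous.continuousAt hs, ?_⟩
  have : IsInducing (fun y : f ⁻¹' s => (⟨f y.1, y.2⟩ : s)) := by
    rw [IsInducing.subtypeVal.of_comp_iff.symm]
    exact hf.comp IsInducing.subtypeVal
  exact weightLT_of_inducing this hw

end weight

/-- `n`-small sets: the first `n` coordinates are constant. -/
def SmallN (n : ℕ) (P : Set (ℕ → T)) : Prop := ∀ x ∈ P, ∀ y ∈ P, ∀ i < n, x i = y i

end MK
end

section
set_option linter.unusedSectionVars false
set_option linter.unusedSimpArgs false
namespace MK

/-- the two cases for the discrete factor -/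
def TCase (k : Cardinal.{u}) (T : Type u) : Prop :=
  (k = Cardinal.aleph0 ∧ Cardinal.mk T = 2) ∨ (Cardinal.aleph0 < k ∧ Cardinal.mk T = k)

theorem TCase.nonempty {k : Cardinal.{u}} {T : Type u} (h : TCase k T) : Nonempty T := by
  rw [← Cardinal.mk_ne_zero_iff]
  rcases h with ⟨_, h⟩ | ⟨h1, h⟩
  · rw [h]; norm_num
  · rw [h]; exact (Cardinal.aleph0_pos.trans h1).ne'

theorem exists_surj {T I : Type u} [Nonempty T] (h : Cardinal.mk T ≤ Cardinal.mk I) :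
    ∃ σ : I → T, Function.Surjective σ := by
  obtain ⟨e⟩ := h
  exact ⟨Function.invFun e, Function.invFun_surjective e.injective⟩

variable {T : Type u} [TopologicalSpace T] [DiscreteTopology T]

def res (n : ℕ) (x : ℕ → T) : Fin n → T := fun i => x i

theorem res_eq_iff {n : ℕ} {x y : ℕ → T} : res n x = res n y ↔ x ∈ PiNat.cylinder y n := by
  rw [funext_iff, PiNat.mem_cylinder_iff]
  exact ⟨fun h i hi => h ⟨i, hi⟩, fun h i => h i i.2⟩

theorem continuous_of_cyl {Y : Type*} [TopologicalSpace Y] (g : (ℕ → T) → Y)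
    (h : ∀ x, ∃ n, ∀ y ∈ PiNat.cylinder x n, g y = g x) : Continuous g := by
  rw [continuous_iff_continuousAt]
  intro x
  obtain ⟨n, hn⟩ := h x
  have : g =ᶠ[𝓝 x] fun _ => g x :=
    mem_of_superset ((isClopen_cyl x n).isOpen.mem_nhds (PiNat.self_mem_cylinder x n)) hn
  exact continuousAt_const.congr this.symm

theorem weightLT_of_res {k κ : Cardinal.{u}} (hk : Cardinal.aleph0 < k) (hκ : κ < k)
    (S : Set (ℕ → T)) (h : ∀ n, Cardinal.mk (res n '' S) ≤ κ) : WeightLT S k := by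
  let F : (Σ n : ℕ, (res n '' S)) → Set S := fun p => {x | res p.1 x.1 = p.2.1}
  refine ⟨range F, ?_, ?_⟩
  · refine TopologicalSpace.isTopologicalBasis_of_isOpen_of_nhds ?_ ?_
    · rintro _ ⟨⟨n, v, y, hy, rfl⟩, rfl⟩
      have : F ⟨n, res n y, y, hy, rfl⟩ = Subtype.val ⁻¹' PiNat.cylinder y n := by
        ext x; exact res_eq_iff
      rw [this]
      exact (isClopen_cyl _ _).isOpen.preimage continuous_subtype_val
    · intro a u ha hu
      obtain ⟨O, hO, rfl⟩ := isOpen_induced_iff.1 hu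
      obtain ⟨n, -, hn⟩ := exists_cyl_subset hO ha 0
      refine ⟨F ⟨n, res n a.1, a.1, a.2, rfl⟩, ⟨_, rfl⟩, rfl, fun x hx => hn (res_eq_iff.1 hx)⟩
  · refine Cardinal.mk_range_le.trans_lt ?_
    rw [Cardinal.mk_sigma]
    refine (Cardinal.sum_le_sum _ (fun _ => κ) h).trans_lt ?_
    rw [Cardinal.sum_const]
    simp only [Cardinal.mk_nat, Cardinal.lift_aleph0, Cardinal.lift_id]
    have : Cardinal.lift.{0} κ = κ := Cardinal.lift_uzero κ
    try rw [this]
    exact Cardinal.mul_lt_of_lt hk.le hk hκ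

theorem splitD_big {k : Cardinal.{u}} (hk : Cardinal.aleph0 < k) (hT : Cardinal.mk T = k)
    [Nonempty T] (S : Set (ℕ → T)) (hne : S.Nonempty)
    (hS : ∀ V, IsClopen V → (S ∩ V).Nonempty → ¬ WeightLT ↥(S ∩ V) k) :
    ∃ g : (ℕ → T) → T, Continuous g ∧ ∀ t, ∃ x ∈ S, g x = t := by
  classical
  by_cases hc : ∃ n, k ≤ Cardinal.mk (res n '' S)
  · obtain ⟨n, hn⟩ := hc
    obtain ⟨σ, hσ⟩ := exists_surj (T := T) (I := res n '' S) (by rw [hT]; exact hn)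
    refine ⟨fun x => if h : res n x ∈ res n '' S then σ ⟨_, h⟩ else Classical.arbitrary T, ?_, ?_⟩
    · refine continuous_of_cyl _ fun x => ⟨n, fun y hy => ?_⟩
      simp only [res_eq_iff.2 hy]
    · intro t
      obtain ⟨⟨_, x, hx, rfl⟩, rfl⟩ := hσ t
      refine ⟨x, hx, ?_⟩
      have hm : res n x ∈ res n '' S := ⟨x, hx, rfl⟩
      exact dif_pos hm
  · push Not at hc
    have big : ∀ V, IsClopen V → (S ∩ V).Nonempty → ∀ κ < k, ∃ n,
        κ < Cardinal.mk (res n '' (S ∩ V)) := by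
      intro V hV hVne κ hκ
      by_contra hcon
      push Not at hcon
      exact hS V hV hVne (weightLT_of_res hk hκ _ hcon)
    have big' : ∀ κ < k, ∃ n, κ < Cardinal.mk (res n '' S) := by
      have := big univ isClopen_univ (by simpa using hne)
      simpa using this
    obtain ⟨n0, hn0⟩ := big' _ hk
    have hinf : (res n0 '' S).Infinite := by
      rw [← Set.infinite_coe_iff, Cardinal.infinite_iff]; exact hn0.le
    let vv := hinf.natEmbedding
    let V : ℕ → Set (ℕ → T) := fun i => {x | res n0 x = (vv i).1}
    have hVc : ∀ i, IsClopen (V i) := by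
      intro i
      obtain ⟨y, hy, hyv⟩ := (vv i).2
      have : V i = PiNat.cylinder y n0 := by
        ext x; change res n0 x = (vv i).1 ↔ _
        rw [← hyv]; exact res_eq_iff
      rw [this]; exact isClopen_cyl _ _
    have hVne : ∀ i, (S ∩ V i).Nonempty := by
      intro i
      obtain ⟨y, hy, hyv⟩ := (vv i).2
      exact ⟨y, hy, hyv⟩
    choose N hN using fun i => big (V i) (hVc i) (hVne i) _ (hc i)
    have hI : k ≤ Cardinal.mk (Σ i, res (N i) '' (S ∩ V i)) := by
      refine le_of_forall_lt fun κ hκ => ?_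
      obtain ⟨i, hi⟩ := big' κ hκ
      refine (hi.trans (hN i)).trans_le ?_
      exact Cardinal.mk_le_of_injective (f := fun p => (⟨i, p⟩ : Σ i, res (N i) '' (S ∩ V i)))
        (fun a b h => eq_of_heq (Sigma.mk.inj h).2)
    obtain ⟨σ, hσ⟩ := exists_surj (T := T) (I := Σ i, res (N i) '' (S ∩ V i)) (hT.le.trans hI)
    let τ : (i : ℕ) → (Fin (N i) → T) → T := fun i w =>
      if h : w ∈ res (N i) '' (S ∩ V i) then σ ⟨i, w, h⟩ else Classical.arbitrary T
    let G : (Fin n0 → T) → (ℕ → T) → T := fun w x =>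
      if h : ∃ i, (vv i).1 = w then τ h.choose (res (N h.choose) x) else Classical.arbitrary T
    refine ⟨fun x => G (res n0 x) x, ?_, ?_⟩
    · refine continuous_of_cyl _ fun x => ?_
      by_cases h : ∃ i, (vv i).1 = res n0 x
      · refine ⟨max n0 (N h.choose), fun y hy => ?_⟩
        have h1 : res n0 y = res n0 x :=
          res_eq_iff.2 (PiNat.cylinder_anti x (le_max_left _ _) hy)
        have h2 : res (N h.choose) y = res (N h.choose) x :=
          res_eq_iff.2 (PiNat.cylinder_anti x (le_max_right _ _) hy)
        simp only [h1]
        simp only [G, dif_pos h, h2]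
      · refine ⟨n0, fun y hy => ?_⟩
        have h1 : res n0 y = res n0 x := res_eq_iff.2 hy
        simp only [h1]
        simp only [G, dif_neg h]
    · intro t
      obtain ⟨⟨i, _, x, hx, rfl⟩, rfl⟩ := hσ t
      refine ⟨x, hx.1, ?_⟩
      have hxi : res n0 x = (vv i).1 := hx.2
      have h : ∃ i, (vv i).1 = res n0 x := ⟨i, hxi.symm⟩
      have hi : h.choose = i := by
        exact vv.injective (Subtype.ext (h.choose_spec.trans hxi))
      simp only [G, dif_pos h]
      rw [hi]
      have hm : res (N i) x ∈ res (N i) '' (S ∩ V i) := ⟨x, hx, rfl⟩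
      exact dif_pos hm

theorem two_cases {T : Type u} (hT : Cardinal.mk T = 2) {a b : T} (hab : a ≠ b) (t : T) :
    t = a ∨ t = b := by
  obtain ⟨x, y, hxy, hu⟩ := Cardinal.mk_eq_two_iff.1 hT
  have h1 : ∀ z, z = x ∨ z = y := fun z => by
    have : z ∈ ({x, y} : Set T) := hu ▸ mem_univ z
    simpa using this
  have := h1 a
  have := h1 b
  have := h1 t
  grind

theorem splitD {k : Cardinal.{u}} (hT : TCase k T) (S : Set (ℕ → T)) (hne : S.Nonempty)
    (hS : ∀ V, IsClopen V → (S ∩ V).Nonempty → ¬ WeightLT ↥(S ∩ V) k) :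
    ∃ g : (ℕ → T) → T, Continuous g ∧ ∀ t, ∃ x ∈ S, g x = t := by
  have hne' := hT.nonempty
  rcases hT with ⟨rfl, hT⟩ | ⟨hk, hT⟩
  · have h2 : ∃ x ∈ S, ∃ y ∈ S, x ≠ y := by
      by_contra hcon
      push Not at hcon
      have hs : Subsingleton ↥(S ∩ univ) :=
        ⟨fun a b => Subtype.ext (hcon _ a.2.1 _ b.2.1)⟩
      refine hS univ isClopen_univ (by simpa using hne)
        ⟨_, TopologicalSpace.isTopologicalBasis_opens, ?_⟩
      rw [Cardinal.lt_aleph0_iff_finite]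
      infer_instance
    obtain ⟨x, hx, y, hy, hxy⟩ := h2
    obtain ⟨i, hi⟩ := Function.ne_iff.1 hxy
    refine ⟨fun z => z i, continuous_apply i, fun t => ?_⟩
    rcases two_cases hT hi t with h | h
    · exact ⟨x, hx, h.symm⟩
    · exact ⟨y, hy, h.symm⟩
  · exact splitD_big hk hT S hne hS

/-- refine a surjective continuous map so that it determines `f` on `U`. -/
theorem refineG {k : Cardinal.{u}} (hT : TCase k T) {Z : Type*} [TopologicalSpace Z]
    (U : Set Z) (f g0 : Z → T) (hf : Continuous f) (hg : Continuous g0)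
    (hs : ∀ t, ∃ x ∈ U, g0 x = t) :
    ∃ g : Z → T, Continuous g ∧ (∀ t, ∃ x ∈ U, g x = t) ∧
      ∀ x ∈ U, ∀ y ∈ U, g x = g y → f x = f y := by
  classical
  have hne' := hT.nonempty
  rcases hT with ⟨-, hT⟩ | ⟨hk, hT⟩
  · by_cases h : ∃ x ∈ U, ∃ y ∈ U, f x ≠ f y
    · obtain ⟨x, hx, y, hy, hxy⟩ := h
      refine ⟨f, hf, fun t => ?_, fun _ _ _ _ h => h⟩
      rcases two_cases hT hxy t with h | h
      · exact ⟨x, hx, h.symm⟩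
      · exact ⟨y, hy, h.symm⟩
    · push Not at h
      exact ⟨g0, hg, hs, fun x hx y hy _ => h x hx y hy⟩
  · let I : Set (T × T) := (fun x => (f x, g0 x)) '' U
    have h1 : Cardinal.mk T ≤ Cardinal.mk I := by
      choose x hx hxt using hs
      refine Cardinal.mk_le_of_injective
        (f := fun t => (⟨(f (x t), t), x t, hx t, by simp [hxt]⟩ : I)) ?_
      intro a b hab
      have := congrArg (fun p : I => p.1.2) hab
      exact this
    have h2 : Cardinal.mk I ≤ Cardinal.mk T := by
      refine (Cardinal.mk_set_le I).trans ?_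
      rw [Cardinal.mk_prod, Cardinal.lift_id, hT]
      exact (Cardinal.mul_eq_self hk.le).le
    obtain ⟨e⟩ := Cardinal.eq.1 (h2.antisymm h1)
    let σ : T × T → T := fun p => if h : p ∈ I then e ⟨p, h⟩ else Classical.arbitrary T
    refine ⟨fun x => σ (f x, g0 x), ?_, ?_, ?_⟩
    · exact (continuous_of_discreteTopology (f := σ)).comp (hf.prodMk hg)
    · intro t
      obtain ⟨⟨p, x, hx, hxp⟩, hp⟩ := e.surjective t
      refine ⟨x, hx, ?_⟩
      have : (f x, g0 x) ∈ I := ⟨x, hx, rfl⟩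
      simp only [σ, dif_pos this]
      rw [← hp]
      congr 1
      exact Subtype.ext hxp
    · intro x hx y hy hxy
      have h1 : (f x, g0 x) ∈ I := ⟨x, hx, rfl⟩
      have h2 : (f y, g0 y) ∈ I := ⟨y, hy, rfl⟩
      simp only [σ, dif_pos h1, dif_pos h2] at hxy
      have := e.injective hxy
      have := congrArg (fun p : I => p.1.1) this
      exact this

/-- splitting of a clopen subset of `T^ω` -/
theorem splitB {k : Cardinal.{u}} (hT : TCase k T) (U : Set (ℕ → T)) (hU : IsOpen U)
    (hne : U.Nonempty) (f : (ℕ → T) → T) (hf : Continuous f) :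
    ∃ g : (ℕ → T) → T, Continuous g ∧ (∀ t, ∃ x ∈ U, g x = t) ∧
      ∀ x ∈ U, ∀ y ∈ U, g x = g y → f x = f y := by
  obtain ⟨x, hx⟩ := hne
  obtain ⟨n, -, hn⟩ := exists_cyl_subset hU hx 0
  refine refineG hT U f (fun y => y n) hf (continuous_apply n) fun t => ?_
  exact ⟨Function.update x n t, hn (PiNat.update_mem_cylinder x n t), by simp⟩

end MK
end

section
set_option linter.unusedSectionVars false
set_option linter.unusedSimpArgs false
namespace MK

variable {T : Type u} [TopologicalSpace T] [DiscreteTopology T]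

theorem embedding_of_cyl {Z : Type*} [TopologicalSpace Z] [T0Space Z] (h : Z → ℕ → T)
    (hc : Continuous h)
    (hs : ∀ z O, IsOpen O → z ∈ O → ∃ n, ∀ z', h z' ∈ PiNat.cylinder (h z) n → z' ∈ O) :
    IsEmbedding h := by
  refine IsInducing.isEmbedding (isInducing_iff_nhds.2 fun z => le_antisymm ?_ ?_)
  · exact (hc.tendsto z).le_comap
  · intro O hO
    obtain ⟨O', hO', hop, hz⟩ := mem_nhds_iff.1 hO
    obtain ⟨n, hn⟩ := hs z O' hop hz
    exact ⟨PiNat.cylinder (h z) n,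
      (isClopen_cyl _ _).isOpen.mem_nhds (PiNat.self_mem_cylinder _ _),
      fun z' hz' => hO' (hn z' hz')⟩

section nodes
variable {Z : Type*} (G : Set Z → ℕ → Z → T)

def node (t : ℕ → T) : ℕ → Set Z
  | 0 => univ
  | n + 1 => node t n ∩ {z | G (node t n) n z = t n}

def pth (z : Z) : ℕ → Set Z
  | 0 => univ
  | n + 1 => pth z n ∩ {y | G (pth z n) n y = G (pth z n) n z}

theorem pth_eq (z : Z) (n : ℕ) : pth G z n = node G (fun n => G (pth G z n) n z) n := by
  induction n with
  | zero => rfl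
  | succ n ih => rw [pth, node, ← ih]

theorem mem_pth (z : Z) (n : ℕ) : z ∈ pth G z n := by
  induction n with
  | zero => trivial
  | succ n ih => exact ⟨ih, rfl⟩

theorem node_congr (t s : ℕ → T) (n : ℕ) (h : ∀ i < n, t i = s i) : node G t n = node G s n := by
  induction n with
  | zero => rfl
  | succ n ih =>
    have := ih fun i hi => h i (hi.trans n.lt_succ_self)
    rw [node, node, this, h n n.lt_succ_self]

theorem pth_of_mem (t : ℕ → T) (z : Z) (n : ℕ) (h : z ∈ node G t n) :
    pth G z n = node G t n ∧ ∀ i < n, G (pth G z i) i z = t i := by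
  induction n with
  | zero => exact ⟨rfl, fun i hi => absurd hi (Nat.not_lt_zero i)⟩
  | succ n ih =>
    obtain ⟨h1, h2⟩ := h
    obtain ⟨h3, h4⟩ := ih h1
    have h5 : G (pth G z n) n z = t n := by rw [h3]; exact h2
    refine ⟨by rw [pth, node, h5, h3], fun i hi => ?_⟩
    rcases Nat.lt_succ_iff_lt_or_eq.1 hi with h | rfl
    · exact h4 i h
    · exact h5

end nodes

/-- existence of a dense embedding -/
theorem dense_embedding {k : Cardinal.{u}} (hT : TCase k T) {Z : Type*} [TopologicalSpace Z]
    [T0Space Z] [Nonempty Z] (f : Z → ℕ → T) (hf : Continuous f)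
    (hsep : ∀ z O, IsOpen O → z ∈ O → ∃ n, ∀ z', f z' n = f z n → z' ∈ O)
    (hsplit : ∀ U : Set Z, IsClopen U → U.Nonempty →
      ∃ g0 : Z → T, Continuous g0 ∧ ∀ t, ∃ x ∈ U, g0 x = t) :
    ∃ h : Z → ℕ → T, IsEmbedding h ∧ DenseRange h := by
  have hG : ∀ (U : Set Z) (n : ℕ), ∃ g : Z → T, (IsClopen U → U.Nonempty →
      Continuous g ∧ (∀ t, ∃ x ∈ U, g x = t) ∧
      ∀ x ∈ U, ∀ y ∈ U, g x = g y → f x n = f y n) := by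
    intro U n
    by_cases h : IsClopen U ∧ U.Nonempty
    · obtain ⟨g0, hg0, hs⟩ := hsplit U h.1 h.2
      obtain ⟨g, hg⟩ := refineG hT U (fun z => f z n) g0 ((continuous_apply n).comp hf) hg0 hs
      exact ⟨g, fun _ _ => hg⟩
    · exact ⟨fun z => f z n, fun h1 h2 => absurd ⟨h1, h2⟩ h⟩
  choose G hG using hG
  have hnode : ∀ t n, IsClopen (node G t n) ∧ (node G t n).Nonempty := by
    intro t n
    induction n with
    | zero => exact ⟨isClopen_univ, univ_nonempty⟩
    | succ n ih =>
      obtain ⟨h1, h2, -⟩ := hG _ n ih.1 ih.2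
      refine ⟨ih.1.inter ?_, ?_⟩
      · exact (isClopen_discrete {t n}).preimage h1
      · obtain ⟨x, hx, hxt⟩ := h2 (t n)
        exact ⟨x, hx, hxt⟩
  let h : Z → ℕ → T := fun z n => G (pth G z n) n z
  have hmem : ∀ z n, z ∈ node G (h z) n := by
    intro z n
    rw [← pth_eq]; exact mem_pth G z n
  have hmem' : ∀ z t n, h z ∈ PiNat.cylinder t n → z ∈ node G t n := by
    intro z t n hz
    rw [← node_congr G (h z) t n hz]; exact hmem z n
  have hcyl : ∀ z t n, z ∈ node G t n → h z ∈ PiNat.cylinder t n := by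
    intro z t n hz i hi
    exact (pth_of_mem G t z n hz).2 i hi
  refine ⟨h, ?_, ?_⟩
  · refine embedding_of_cyl h ?_ ?_
    · refine continuous_pi fun n => ?_
      rw [continuous_iff_continuousAt]
      intro z
      have : (fun y => h y n) =ᶠ[𝓝 z] fun _ => h z n := by
        refine mem_of_superset ((hnode (h z) (n+1)).1.isOpen.mem_nhds (hmem z (n+1))) ?_
        intro y hy
        exact hcyl y _ _ hy n n.lt_succ_self
      exact continuousAt_const.congr this.symm
    · intro z O hO hz
      obtain ⟨n, hn⟩ := hsep z O hO hz
      refine ⟨n + 1, fun z' hz' => hn z' ?_⟩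
      have h1 := hmem' _ _ _ hz'
      have h2 := hmem z (n+1)
      exact (hG _ n (hnode (h z) n).1 (hnode (h z) n).2).2.2 _ h1.1 _ h2.1 (h1.2.trans h2.2.symm)
  · intro t
    rw [mem_closure_iff]
    intro O hO ht
    obtain ⟨n, -, hn⟩ := exists_cyl_subset hO ht 0
    obtain ⟨z, hz⟩ := (hnode t n).2
    exact ⟨h z, hn (hcyl z t n hz), z, rfl⟩

theorem dense_omega (hT : Cardinal.mk T = 2) {Z : Type*} [TopologicalSpace Z]
    [T1Space Z] [Nonempty Z] {ι : Type*} [Countable ι] (C : ι → Set Z)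
    (hC : ∀ i, IsClopen (C i)) (hb : ∀ z O, IsOpen O → z ∈ O → ∃ i, z ∈ C i ∧ C i ⊆ O)
    (hiso : ∀ z : Z, ¬ IsOpen {z}) :
    ∃ h : Z → ℕ → T, IsEmbedding h ∧ DenseRange h := by
  classical
  obtain ⟨a, b, hab, -⟩ := Cardinal.mk_eq_two_iff.1 hT
  have hι : Nonempty ι := by
    obtain ⟨z⟩ := (inferInstance : Nonempty Z)
    obtain ⟨i, _⟩ := hb z univ isOpen_univ trivial
    exact ⟨i⟩
  obtain ⟨c, hc⟩ := exists_surjective_nat ι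
  have hind : ∀ i, Continuous (fun z => if z ∈ C i then a else b) := by
    intro i
    refine Continuous.if (fun z hz => ?_) continuous_const continuous_const
    have h1 : frontier {z | z ∈ C i} = ∅ := (hC i).frontier_eq
    rw [h1] at hz
    exact absurd hz (notMem_empty z)
  refine dense_embedding (k := Cardinal.aleph0) (Or.inl ⟨rfl, hT⟩)
    (fun z n => if z ∈ C (c n) then a else b) ?_ ?_ ?_
  · exact continuous_pi fun n => hind _
  · intro z O hO hz
    obtain ⟨i, hi, hs⟩ := hb z O hO hz
    obtain ⟨n, rfl⟩ := hc i
    refine ⟨n, fun z' hz' => hs ?_⟩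
    by_contra hcon
    simp only [if_neg hcon, if_pos hi] at hz'
    exact hab hz'.symm
  · rintro U hU ⟨x, hx⟩
    have : ∃ y ∈ U, y ≠ x := by
      by_contra hcon
      push Not at hcon
      refine hiso x ?_
      rw [← eq_singleton_iff_unique_mem.2 ⟨hx, hcon⟩]
      exact hU.isOpen
    obtain ⟨y, hy, hyx⟩ := this
    obtain ⟨i, hi, hs⟩ := hb x {y}ᶜ isOpen_compl_singleton (Ne.symm hyx)
    refine ⟨_, hind i, fun t => ?_⟩
    rcases two_cases hT hab t with rfl | rfl
    · exact ⟨x, hx, if_pos hi⟩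
    · exact ⟨y, hy, if_neg fun h => hs h rfl⟩

theorem clopen_partition {X : Type u} [TopologicalSpace X] [TopologicalSpace.MetrizableSpace X]
    (hind : StronglyZeroDim X) {ι : Type u} (U : ι → Set X) (hU : ∀ i, IsOpen (U i))
    (hcov : ⋃ i, U i = univ) :
    ∃ p : X → ι, (∀ x, ∀ᶠ y in 𝓝 x, p y = p x) ∧ ∀ x, x ∈ U (p x) := by
  classical
  let _ := TopologicalSpace.metrizableSpaceMetric X
  obtain ⟨v, hvo, hvc, hvf, hvs⟩ := precise_refinement U hU hcov
  obtain ⟨c, hcc, hccl, hcs⟩ := exists_iUnion_eq_closed_subset hvo (fun x => hvf.point_finite x) hvc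
  have : ∀ i, ∃ w, IsClopen w ∧ c i ⊆ w ∧ w ⊆ v i := by
    intro i
    obtain ⟨w, hw, h1, h2⟩ := hind (c i) (v i)ᶜ (hccl i) (hvo i).isClosed_compl
      (disjoint_compl_right_iff_subset.2 (hcs i))
    refine ⟨w, hw, h1, ?_⟩
    exact disjoint_compl_left_iff_subset.1 h2
  choose w hw hcw hwv using this
  have hwf : LocallyFinite w := hvf.subset hwv
  have hne : ∀ x, ∃ i, x ∈ w i := fun x => by
    have : x ∈ ⋃ i, c i := by rw [hcc]; trivial
    obtain ⟨i, hi⟩ := mem_iUnion.1 this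
    exact ⟨i, hcw i hi⟩
  have hS : ∀ x, {i | x ∈ w i}.Nonempty := hne
  refine ⟨fun x => (hS x).some, fun x => ?_, fun x => ?_⟩
  · obtain ⟨N, hN, hF⟩ := hwf x
    have h1 : ∀ i ∈ {i | (w i ∩ N).Nonempty}, ∀ᶠ y in 𝓝 x, (y ∈ w i ↔ x ∈ w i) := by
      intro i _
      by_cases hx : x ∈ w i
      · filter_upwards [(hw i).isOpen.mem_nhds hx] with y hy
        simp [hx, hy]
      · filter_upwards [(hw i).compl.isOpen.mem_nhds hx] with y hy
        simpa [hx] using hy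
    filter_upwards [(eventually_all_finite hF).2 h1, hN] with y hy hyN
    have : {i | y ∈ w i} = {i | x ∈ w i} := by
      ext i
      by_cases hi : (w i ∩ N).Nonempty
      · exact hy i hi
      · have h2 : ∀ z ∈ N, z ∉ w i := fun z hz hzi => hi ⟨z, hzi, hz⟩
        simp [h2 y hyN, h2 x (mem_of_mem_nhds hN)]
    simp only [this]
  · exact hvs _ (hwv _ (hS x).some_mem)

theorem exists_basis {X : Type u} [TopologicalSpace X] {k : Cardinal.{u}} (hw : topWeight X = k) :
    ∃ B : Set (Set X), TopologicalSpace.IsTopologicalBasis B ∧ Cardinal.mk B = k := by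
  have : Nonempty {B : Set (Set X) // TopologicalSpace.IsTopologicalBasis B} :=
    ⟨⟨_, TopologicalSpace.isTopologicalBasis_opens⟩⟩
  obtain ⟨B, hB⟩ := ciInf_mem
    (fun B : {B : Set (Set X) // TopologicalSpace.IsTopologicalBasis B} => Cardinal.mk B.1)
  exact ⟨B.1, B.2, hB.trans hw⟩

theorem embed_X {k : Cardinal.{u}} (hT : TCase k T) {X : Type u} [TopologicalSpace X] [Nonempty X]
    [TopologicalSpace.MetrizableSpace X] (hind : StronglyZeroDim X) (hw : topWeight X = k)
    (hns : ∀ U : Set X, IsOpen U → U.Nonempty → ¬ WeightLT ↥U k) :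
    ∃ e : X → ℕ → T, IsEmbedding e ∧ DenseRange e := by
  classical
  obtain ⟨B, hB, hBk⟩ := exists_basis hw
  rcases id hT with ⟨rfl, hT2⟩ | ⟨hk, hTk⟩
  · have hBc : Countable B := Cardinal.mk_le_aleph0_iff.1 hBk.le
    let ι := {p : B × B // ∃ c : Set X, IsClopen c ∧ p.1.1 ⊆ c ∧ c ⊆ p.2.1}
    refine dense_omega hT2 (ι := ι) (fun p => p.2.choose) (fun p => p.2.choose_spec.1) ?_ ?_
    · intro z O hO hz
      obtain ⟨b, hb, hzb, hbO⟩ := hB.exists_subset_of_mem_open hz hO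
      obtain ⟨c, hc, hzc, hcb⟩ := hind {z} bᶜ isClosed_singleton (hB.isOpen hb).isClosed_compl
        (by simpa using hzb)
      have hcb' : c ⊆ b := disjoint_compl_left_iff_subset.1 hcb
      obtain ⟨b', hb', hzb', hbc⟩ :=
        hB.exists_subset_of_mem_open (singleton_subset_iff.1 hzc) hc.isOpen
      let p : ι := ⟨(⟨b', hb'⟩, ⟨b, hb⟩), c, hc, hbc, hcb'⟩
      exact ⟨p, p.2.choose_spec.2.1 hzb', p.2.choose_spec.2.2.trans hbO⟩
    · intro z hz
      refine hns {z} hz (singleton_nonempty z) ⟨_, TopologicalSpace.isTopologicalBasis_opens, ?_⟩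
      rw [Cardinal.lt_aleph0_iff_finite]
      infer_instance
  · let _ := TopologicalSpace.metrizableSpaceMetric X
    have hp : ∀ n : ℕ, ∃ f : X → T, Continuous f ∧
        ∀ x y, f x = f y → dist x y < 1 / ((n : ℝ) + 1) := by
      intro n
      let ι := {b : B // ∀ x ∈ b.1, ∀ y ∈ b.1, dist x y < 1 / ((n : ℝ) + 1)}
      obtain ⟨p, hp1, hp2⟩ := clopen_partition hind (ι := ι) (fun i => i.1.1)
        (fun i => hB.isOpen i.1.2) (by
          rw [eq_univ_iff_forall]
          intro x
          obtain ⟨b, hb, hxb, hbs⟩ := hB.exists_subset_of_mem_open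
            (Metric.mem_ball_self (x := x) (ε := 1 / ((n : ℝ) + 1) / 2) (by positivity))
            Metric.isOpen_ball
          refine mem_iUnion.2 ⟨⟨⟨b, hb⟩, fun a ha c hc => ?_⟩, hxb⟩
          have h1 := hbs ha
          have h2 := hbs hc
          have := dist_triangle_right a c x
          rw [Metric.mem_ball] at h1 h2
          linarith)
      have hι : Cardinal.mk ι ≤ Cardinal.mk T := by
        rw [hTk, ← hBk]
        exact Cardinal.mk_le_of_injective Subtype.val_injective
      obtain ⟨j⟩ := hι
      refine ⟨fun x => j (p x), ?_, fun x y hxy => ?_⟩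
      · rw [continuous_iff_continuousAt]
        intro x
        have : (fun y => j (p y)) =ᶠ[𝓝 x] fun _ => j (p x) := by
          filter_upwards [hp1 x] with y hy
          rw [hy]
        exact continuousAt_const.congr this.symm
      · have h1 := j.injective hxy
        exact (p x).2 x (hp2 x) y (h1 ▸ hp2 y)
    choose f hfc hfs using hp
    have hf : Continuous (fun x n => f n x) := continuous_pi hfc
    have hsep : ∀ z O, IsOpen O → z ∈ O → ∃ n, ∀ z', f n z' = f n z → z' ∈ O := by
      intro z O hO hz
      obtain ⟨ε, hε, hs⟩ := Metric.isOpen_iff.1 hO z hz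
      obtain ⟨n, hn⟩ := exists_nat_one_div_lt hε
      exact ⟨n, fun z' hz' => hs ((hfs n _ _ hz').trans hn)⟩
    have hfe : IsEmbedding (fun x n => f n x) := by
      refine embedding_of_cyl _ hf fun z O hO hz => ?_
      obtain ⟨n, hn⟩ := hsep z O hO hz
      exact ⟨n + 1, fun z' hz' => hn z' (hz' n n.lt_succ_self)⟩
    refine dense_embedding hT (fun x n => f n x) hf hsep ?_
    intro U hU hUne
    obtain ⟨g, hg, hgs⟩ := splitD hT ((fun x n => f n x) '' U) (hUne.image _) (by
      rintro V hV ⟨_, ⟨x, hx, rfl⟩, hxV⟩ hlt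
      refine hns (U ∩ (fun x n => f n x) ⁻¹' V) (hU.isOpen.inter (hV.isOpen.preimage hf))
        ⟨x, hx, hxV⟩ ?_
      refine weightLT_of_inducing (f := fun y : ↥(U ∩ (fun x n => f n x) ⁻¹' V) =>
        (⟨fun n => f n y.1, ⟨y.1, y.2.1, rfl⟩, y.2.2⟩ :
          ↥((fun x n => f n x) '' U ∩ V))) ?_ hlt
      rw [IsInducing.subtypeVal.of_comp_iff.symm]
      exact hfe.isInducing.comp IsInducing.subtypeVal)
    refine ⟨_, hg.comp hf, fun t => ?_⟩
    obtain ⟨_, ⟨x, hx, rfl⟩, hxt⟩ := hgs t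
    exact ⟨x, hx, hxt⟩

end MK
end

section
set_option linter.unusedSectionVars false
set_option linter.unusedSimpArgs false
namespace MK

variable {T : Type u} [TopologicalSpace T] [DiscreteTopology T]

theorem weightLT_mono {B : Type u} [TopologicalSpace B] {k : Cardinal.{u}} {S S' : Set B}
    (h : S ⊆ S') (hw : WeightLT ↥S' k) : WeightLT ↥S k :=
  weightLT_of_inducing (IsEmbedding.inclusion h).isInducing hw

theorem lw_iff {B : Type u} [TopologicalSpace B] {k : Cardinal.{u}} {A : Set B} :
    LocallyWeightLT ↥A k ↔ ∀ y ∈ A, ∃ O, IsOpen O ∧ y ∈ O ∧ WeightLT ↥(A ∩ O) k := by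
  constructor
  · intro h y hy
    obtain ⟨s, hs, hw⟩ := h ⟨y, hy⟩
    obtain ⟨t, hts, hto, hyt⟩ := mem_nhds_iff.1 hs
    obtain ⟨O, hO, rfl⟩ := isOpen_induced_iff.1 hto
    refine ⟨O, hO, hyt, weightLT_of_inducing
      (f := fun z : ↥(A ∩ O) => (⟨⟨z.1, z.2.1⟩, hts z.2.2⟩ : s)) ?_ hw⟩
    rw [IsInducing.subtypeVal.of_comp_iff.symm, IsInducing.subtypeVal.of_comp_iff.symm]
    exact IsInducing.subtypeVal
  · rintro h ⟨y, hy⟩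
    obtain ⟨O, hO, hyO, hw⟩ := h y hy
    refine ⟨Subtype.val ⁻¹' O, (hO.preimage continuous_subtype_val).mem_nhds hyO,
      weightLT_of_inducing (f := fun z : ↥(Subtype.val ⁻¹' O : Set A) =>
        (⟨z.1.1, z.1.2, z.2⟩ : ↥(A ∩ O))) ?_ hw⟩
    rw [IsInducing.subtypeVal.of_comp_iff.symm]
    exact (IsInducing.subtypeVal (t := A)).comp
      (IsInducing.subtypeVal (t := (Subtype.val ⁻¹' O : Set A)))

/-- the ideal of small sets -/
def Small (k : Cardinal.{u}) (XB : Set (ℕ → T)) (S : Set (ℕ → T)) : Prop :=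
  ∃ A G : ℕ → Set (ℕ → T), S ⊆ (⋃ n, A n) ∪ (⋃ n, G n) ∧ (∀ n, LocallyWeightLT ↥(A n) k) ∧
    (∀ n, IsGδ (G n)) ∧ ∀ n, G n ⊆ XB

def JSmall (k : Cardinal.{u}) (XB Y : Set (ℕ → T)) (E : Set (ℕ → T)) : Prop :=
  ∃ S H : Set (ℕ → T), E ⊆ S ∪ H ∧ Small k XB S ∧ IsGδ H ∧ H ⊆ Y

theorem lw_empty (k : Cardinal.{u}) : LocallyWeightLT ↥(∅ : Set (ℕ → T)) k :=
  fun x => absurd x.2 (notMem_empty _)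

theorem small_mono {k : Cardinal.{u}} {XB S S' : Set (ℕ → T)} (h : S ⊆ S') (hs : Small k XB S') :
    Small k XB S := by
  obtain ⟨A, G, h1, h2⟩ := hs
  exact ⟨A, G, h.trans h1, h2⟩

theorem small_gdelta {k : Cardinal.{u}} {XB G : Set (ℕ → T)} (h : IsGδ G) (h' : G ⊆ XB) :
    Small k XB G :=
  ⟨fun _ => ∅, fun _ => G, fun _ hx => Or.inr (mem_iUnion.2 ⟨0, hx⟩), fun _ => lw_empty k,
    fun _ => h, fun _ => h'⟩

theorem small_weight {k : Cardinal.{u}} {XB S : Set (ℕ → T)} (h : WeightLT ↥S k) :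
    Small k XB S :=
  ⟨fun _ => S, fun _ => ∅, fun x hx => Or.inl (mem_iUnion.2 ⟨0, hx⟩),
    fun _ => lw_iff.2 fun y _ => ⟨univ, isOpen_univ, trivial, by rwa [inter_univ]⟩,
    fun _ => isOpen_empty.isGδ, fun _ => empty_subset _⟩

theorem small_iUnion {k : Cardinal.{u}} {XB : Set (ℕ → T)} {S : ℕ → Set (ℕ → T)}
    (h : ∀ n, Small k XB (S n)) : Small k XB (⋃ n, S n) := by
  choose A G h1 h2 h3 h4 using h
  refine ⟨fun p => A p.unpair.1 p.unpair.2, fun p => G p.unpair.1 p.unpair.2, ?_,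
    fun _ => h2 _ _, fun _ => h3 _ _, fun _ => h4 _ _⟩
  refine iUnion_subset fun n x hx => ?_
  rcases h1 n hx with h | h
  · obtain ⟨m, hm⟩ := mem_iUnion.1 h
    exact Or.inl (mem_iUnion.2 ⟨Nat.pair n m, by simpa using hm⟩)
  · obtain ⟨m, hm⟩ := mem_iUnion.1 h
    exact Or.inr (mem_iUnion.2 ⟨Nat.pair n m, by simpa using hm⟩)

theorem small_union {k : Cardinal.{u}} {XB S S' : Set (ℕ → T)}
    (h : Small k XB S) (h' : Small k XB S') : Small k XB (S ∪ S') := by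
  refine small_mono ?_ (small_iUnion (S := fun n => if n = 0 then S else S') ?_)
  · rintro x (hx | hx)
    · exact mem_iUnion.2 ⟨0, by simpa using hx⟩
    · exact mem_iUnion.2 ⟨1, by simpa using hx⟩
  · intro n
    by_cases hn : n = 0
    · simpa [hn] using h
    · simpa [hn] using h'

section patch
variable {B : Type u} [TopologicalSpace B] {W : Set B} {C : B → Set B}

theorem patch_open
    (hC : ∀ y ∈ W, IsOpen (C y) ∧ y ∈ C y ∧ ∀ z ∈ C y, z ∈ W ∧ C z = C y)
    {O : Set B → Set B} (hO : ∀ V, IsOpen (O V)) :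
    IsOpen {y | y ∈ W ∧ y ∈ O (C y)} := by
  rw [isOpen_iff_forall_mem_open]
  rintro y ⟨hy, hyO⟩
  obtain ⟨h1, h2, h3⟩ := hC y hy
  refine ⟨C y ∩ O (C y), fun z hz => ⟨(h3 z hz.1).1, ?_⟩, h1.inter (hO _), h2, hyO⟩
  rw [(h3 z hz.1).2]; exact hz.2

theorem patch_gdelta
    (hC : ∀ y ∈ W, IsOpen (C y) ∧ y ∈ C y ∧ ∀ z ∈ C y, z ∈ W ∧ C z = C y)
    {G : Set B → Set B} (hG : ∀ V, IsGδ (G V)) :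
    IsGδ {y | y ∈ W ∧ y ∈ G (C y)} := by
  choose O hO hOe using fun V => isGδ_iff_eq_iInter_nat.1 (hG V)
  have : {y | y ∈ W ∧ y ∈ G (C y)} = ⋂ n, {y | y ∈ W ∧ y ∈ O (C y) n} := by
    ext y
    simp only [mem_ofPred_eq, mem_iInter]
    rw [hOe, mem_iInter]
    exact ⟨fun h n => ⟨h.1, h.2 n⟩, fun h => ⟨(h 0).1, fun n => (h n).2⟩⟩
  rw [this]
  exact IsGδ.iInter_of_isOpen fun n => patch_open hC (O := fun V => O V n) fun V => hO V n

theorem patch_lw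
    (hC : ∀ y ∈ W, IsOpen (C y) ∧ y ∈ C y ∧ ∀ z ∈ C y, z ∈ W ∧ C z = C y)
    {k : Cardinal.{u}} {A : Set B → Set B} (hA : ∀ V, LocallyWeightLT ↥(A V) k) :
    LocallyWeightLT ↥{y | y ∈ W ∧ y ∈ A (C y)} k := by
  rw [lw_iff]
  rintro y ⟨hy, hyA⟩
  obtain ⟨h1, h2, h3⟩ := hC y hy
  obtain ⟨O, hO, hyO, hw⟩ := lw_iff.1 (hA (C y)) y hyA
  refine ⟨C y ∩ O, h1.inter hO, ⟨h2, hyO⟩, weightLT_mono ?_ hw⟩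
  rintro z ⟨⟨-, hz⟩, hzC, hzO⟩
  rw [(h3 z hzC).2] at hz
  exact ⟨hz, hzO⟩
end patch

theorem jsmall_mono {k : Cardinal.{u}} {XB Y E E' : Set (ℕ → T)} (h : E ⊆ E')
    (hs : JSmall k XB Y E') : JSmall k XB Y E := by
  obtain ⟨S, H, h1, h2⟩ := hs
  exact ⟨S, H, h.trans h1, h2⟩

theorem jsmall_empty {k : Cardinal.{u}} {XB Y : Set (ℕ → T)} : JSmall k XB Y ∅ :=
  ⟨∅, ∅, empty_subset _, small_gdelta isOpen_empty.isGδ (empty_subset _), isOpen_empty.isGδ,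
    empty_subset _⟩

theorem jsmall_local {k : Cardinal.{u}} {XB Y E : Set (ℕ → T)} :
    JSmall k XB Y (E ∩ {x | ∃ n, JSmall k XB Y (E ∩ PiNat.cylinder x n)}) := by
  classical
  set W := {x | ∃ n, JSmall k XB Y (E ∩ PiNat.cylinder x n)} with hWdef
  let N : (ℕ → T) → ℕ := fun x => if h : x ∈ W then Nat.find h else 0
  let C : (ℕ → T) → Set (ℕ → T) := fun x => PiNat.cylinder x (N x)
  have hN : ∀ x ∈ W, JSmall k XB Y (E ∩ C x) := by
    intro x hx
    have : N x = Nat.find hx := dif_pos hx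
    simp only [C, this]
    exact Nat.find_spec hx
  have hNle : ∀ x, ∀ n, JSmall k XB Y (E ∩ PiNat.cylinder x n) → N x ≤ n := by
    intro x n h
    have hx : x ∈ W := ⟨n, h⟩
    have : N x = Nat.find hx := dif_pos hx
    rw [this]; exact Nat.find_min' hx h
  have hC : ∀ y ∈ W, IsOpen (C y) ∧ y ∈ C y ∧ ∀ z ∈ C y, z ∈ W ∧ C z = C y := by
    intro y hy
    refine ⟨(isClopen_cyl _ _).isOpen, PiNat.self_mem_cylinder _ _, fun z hz => ?_⟩
    have h1 : PiNat.cylinder z (N y) = C y := PiNat.mem_cylinder_iff_eq.1 hz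
    have h2 : JSmall k XB Y (E ∩ PiNat.cylinder z (N y)) := by rw [h1]; exact hN y hy
    have hzW : z ∈ W := ⟨_, h2⟩
    refine ⟨hzW, ?_⟩
    have h3 : N z ≤ N y := hNle z _ h2
    have h4 : PiNat.cylinder y (N z) = PiNat.cylinder z (N z) := by
      rw [← PiNat.mem_cylinder_iff_eq, PiNat.mem_cylinder_comm]
      exact PiNat.cylinder_anti y h3 hz
    have h5 : N y ≤ N z := hNle y _ (by rw [h4]; exact hN z hzW)
    have h6 : N z = N y := le_antisymm h3 h5
    show PiNat.cylinder z (N z) = C y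
    rw [h6, h1]
  have key : ∀ V, ∃ (A G : ℕ → Set (ℕ → T)) (H : Set (ℕ → T)),
      (JSmall k XB Y (E ∩ V) → E ∩ V ⊆ ((⋃ n, A n) ∪ (⋃ n, G n)) ∪ H) ∧
      (∀ n, LocallyWeightLT ↥(A n) k) ∧
      (∀ n, IsGδ (G n)) ∧ (∀ n, G n ⊆ XB) ∧ IsGδ H ∧ H ⊆ Y := by
    intro V
    by_cases h : JSmall k XB Y (E ∩ V)
    · obtain ⟨S, H, h1, ⟨A, G, h2, h3, h4, h5⟩, h6, h7⟩ := h
      exact ⟨A, G, H, fun _ => h1.trans (union_subset_union_left _ h2), h3, h4, h5, h6, h7⟩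
    · exact ⟨fun _ => ∅, fun _ => ∅, ∅, fun h' => absurd h' h, fun _ => lw_empty k,
        fun _ => isOpen_empty.isGδ, fun _ => empty_subset _, isOpen_empty.isGδ, empty_subset _⟩
  choose A G H h1 h2 h3 h4 h5 h6 using key
  refine ⟨(⋃ n, {y | y ∈ W ∧ y ∈ A (C y) n}) ∪ ⋃ n, {y | y ∈ W ∧ y ∈ G (C y) n},
    {y | y ∈ W ∧ y ∈ H (C y)}, ?_, ⟨_, _, Subset.rfl, ?_, ?_, ?_⟩, ?_, ?_⟩
  · rintro x ⟨hxE, hxW⟩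
    have := h1 (C x) (hN x hxW) ⟨hxE, (hC x hxW).2.1⟩
    simp only [mem_union, mem_iUnion, mem_ofPred_eq] at this ⊢
    rcases this with (⟨n, h⟩ | ⟨n, h⟩) | h
    · exact Or.inl (Or.inl ⟨n, hxW, h⟩)
    · exact Or.inl (Or.inr ⟨n, hxW, h⟩)
    · exact Or.inr ⟨hxW, h⟩
  · exact fun n => patch_lw hC (A := fun V => A V n) fun V => h2 V n
  · exact fun n => patch_gdelta hC (G := fun V => G V n) fun V => h3 V n
  · rintro n y ⟨-, hy⟩
    exact h4 _ _ hy
  · exact patch_gdelta hC h5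
  · rintro y ⟨-, hy⟩
    exact h6 _ hy

/-- `n`-good sets -/
def Good (k : Cardinal.{u}) (XB : Set (ℕ → T)) (Xc : ℕ → ℕ → Set (ℕ → T)) (n : ℕ)
    (E : Set (ℕ → T)) : Prop :=
  E ⊆ XB ∧ ∀ V, IsClopen V → (E ∩ V).Nonempty → ¬ Small k XB (E ∩ V) ∧ ∀ m, ¬ (E ∩ V ⊆ Xc n m)

theorem good_inter {k : Cardinal.{u}} {XB : Set (ℕ → T)} {Xc : ℕ → ℕ → Set (ℕ → T)} {n : ℕ}
    {E V : Set (ℕ → T)} (h : Good k XB Xc n E) (hV : IsClopen V) : Good k XB Xc n (E ∩ V) := by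
  refine ⟨inter_subset_left.trans h.1, fun V' hV' hne => ?_⟩
  rw [inter_assoc] at hne ⊢
  exact h.2 _ (hV.inter hV') hne

theorem lemmaK {k : Cardinal.{u}} {XB : Set (ℕ → T)} {Xc : ℕ → ℕ → Set (ℕ → T)}
    (hXc : ∀ n m, IsClosed (Xc n m)) (hX : XB = ⋂ n, ⋃ m, Xc n m) {E : Set (ℕ → T)}
    (hE : E ⊆ XB) (hs : ¬ Small k XB E) :
    ∃ n E', E' ⊆ E ∧ E'.Nonempty ∧ Good k XB Xc n E' := by
  have h1 : ∃ n, ¬ JSmall k XB (⋃ m, Xc n m) E := by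
    by_contra hcon
    push Not at hcon
    choose S H h1 h2 h3 h4 using hcon
    refine hs (small_mono (S' := (⋃ n, S n) ∪ ⋂ n, H n) ?_
      (small_union (small_iUnion h2) (small_gdelta (.iInter h3) ?_)))
    · intro x hx
      by_cases h : ∃ n, x ∈ S n
      · exact Or.inl (mem_iUnion.2 h)
      · push Not at h
        exact Or.inr (mem_iInter.2 fun n => (h1 n hx).resolve_left (h n))
    · rw [hX]
      exact iInter_mono h4
  obtain ⟨n, hn⟩ := h1
  set Y := ⋃ m, Xc n m with hY
  set W := {x | ∃ i, JSmall k XB Y (E ∩ PiNat.cylinder x i)} with hW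
  have hJW : JSmall k XB Y (E ∩ W) := jsmall_local
  have hWo : IsOpen W := by
    rw [isOpen_iff_forall_mem_open]
    rintro x ⟨i, hi⟩
    refine ⟨PiNat.cylinder x i, fun y hy => ⟨i, ?_⟩, (isClopen_cyl _ _).isOpen,
      PiNat.self_mem_cylinder _ _⟩
    rw [PiNat.mem_cylinder_iff_eq.1 hy]; exact hi
  have key : ∀ V, IsClopen V → JSmall k XB Y (E ∩ V) → V ⊆ W := by
    intro V hV h x hx
    obtain ⟨i, -, hi⟩ := exists_cyl_subset hV.isOpen hx 0
    exact ⟨i, jsmall_mono (inter_subset_inter_right _ hi) h⟩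
  obtain ⟨S, H, hSH, hS, hH, hHY⟩ := hJW
  refine ⟨n, E \ W, sdiff_subset, ?_, sdiff_subset.trans hE, ?_⟩
  · by_contra hcon
    rw [not_nonempty_iff_eq_empty, sdiff_eq_empty] at hcon
    exact hn ⟨S, H, (subset_inter Subset.rfl hcon).trans hSH, hS, hH, hHY⟩
  · rintro V hV ⟨x, ⟨hxE, hxW⟩, hxV⟩
    constructor
    · intro hsm
      refine hxW (key V hV ⟨S ∪ ((E \ W) ∩ V), H, ?_, small_union hS hsm, hH, hHY⟩ hxV)
      rintro y ⟨hyE, hyV⟩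
      by_cases hyW : y ∈ W
      · rcases hSH ⟨hyE, hyW⟩ with h | h
        · exact Or.inl (Or.inl h)
        · exact Or.inr h
      · exact Or.inl (Or.inr ⟨⟨hyE, hyW⟩, hyV⟩)
    · intro m hsub
      refine hxW (key V hV ⟨S, H ∪ (Wᶜ ∩ Xc n m), ?_, hS,
        hH.union (hWo.isClosed_compl.inter (hXc n m)).isGδ, union_subset hHY ?_⟩ hxV)
      · rintro y ⟨hyE, hyV⟩
        by_cases hyW : y ∈ W
        · rcases hSH ⟨hyE, hyW⟩ with h | h
          · exact Or.inl h
          · exact Or.inr (Or.inl h)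
        · exact Or.inr (Or.inr ⟨hyW, hsub ⟨⟨hyE, hyW⟩, hyV⟩⟩)
      · exact inter_subset_right.trans (subset_iUnion _ m)

/-- nonsmallness of the clopen pieces of `X` -/
theorem nonsmall_X {k : Cardinal.{u}} {X : Type u} [TopologicalSpace X]
    (hnw : NowhereSLWplusGDS X k) [TopologicalSpace.MetrizableSpace X]
    (e : X → ℕ → T) (he : IsEmbedding e) (hd : DenseRange e) {Q : Set (ℕ → T)} (hQ : IsClopen Q)
    (hne : Q.Nonempty) : ¬ Small k (range e) (range e ∩ Q) := by
  rintro ⟨A, G, h1, h2, h3, h4⟩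
  have hUne : (e ⁻¹' Q).Nonempty := by
    obtain ⟨x, hx⟩ := hd.exists_mem_open hQ.isOpen hne
    exact ⟨x, hx⟩
  refine hnw (e ⁻¹' Q) (hQ.isOpen.preimage he.continuous) hUne
    ⟨{x | e x.1 ∈ ⋃ n, A n}, {x | e x.1 ∈ ⋃ n, G n}, ?_, ?_, ?_⟩
  · rw [eq_univ_iff_forall]
    exact fun x => h1 ⟨⟨x.1, rfl⟩, x.2⟩
  · refine ⟨fun n => {x | e x.1.1 ∈ A n}, ?_, fun n => ?_⟩
    · rw [eq_univ_iff_forall]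
      intro x
      obtain ⟨n, hn⟩ := mem_iUnion.1 x.2
      exact mem_iUnion.2 ⟨n, hn⟩
    · refine lw_of_inducing (f := fun x => (⟨e x.1.1.1, x.2⟩ : A n)) ?_ (h2 n)
      rw [IsInducing.subtypeVal.of_comp_iff.symm]
      exact he.isInducing.comp
        (IsInducing.subtypeVal.comp (IsInducing.subtypeVal.comp IsInducing.subtypeVal))
  · refine ⟨inferInstance, fun Y _ _ f hf => ?_⟩
    have hψ : IsEmbedding (fun x : {x : ↥(e ⁻¹' Q) | e x.1 ∈ ⋃ n, G n} => e x.1.1) :=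
      he.comp (IsEmbedding.subtypeVal.comp IsEmbedding.subtypeVal)
    have hx : ∀ n, ∀ y : ↥(G n ∩ Q), ∃ x, e x = y.1 := fun n y => h4 n y.2.1
    choose φ hφ using hx
    let φ' : ∀ n, ↥(G n ∩ Q) → {x : ↥(e ⁻¹' Q) | e x.1 ∈ ⋃ n, G n} := fun n y =>
      ⟨⟨φ n y, by rw [mem_preimage, hφ]; exact y.2.2⟩, by
        show e (φ n y) ∈ ⋃ n, G n
        rw [hφ]; exact mem_iUnion.2 ⟨n, y.2.1⟩⟩
    have hφ' : ∀ n, IsEmbedding (φ' n) := by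
      intro n
      rw [← hψ.of_comp_iff]
      have : (fun x : {x : ↥(e ⁻¹' Q) | e x.1 ∈ ⋃ n, G n} => e x.1.1) ∘ φ' n = Subtype.val := by
        funext y; exact hφ n y
      rw [this]
      exact IsEmbedding.subtypeVal
    refine ⟨fun n => range (f ∘ φ' n), fun n => ?_, ?_⟩
    · exact gdelta_cyl _ ((h3 n).inter hQ.isOpen.isGδ) _ (hf.comp (hφ' n))
    · ext y
      rw [mem_iUnion]
      constructor
      · rintro ⟨x, rfl⟩
        obtain ⟨n, hn⟩ := mem_iUnion.1 x.2
        refine ⟨n, ⟨e x.1.1, hn, x.1.2⟩, ?_⟩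
        show f _ = f x
        congr 1
        exact hψ.injective (hφ n _)
      · rintro ⟨n, z, rfl⟩
        exact ⟨_, rfl⟩

end MK
end

section
set_option linter.unusedSectionVars false
set_option linter.unusedSimpArgs false
namespace MK

variable {T : Type u} [TopologicalSpace T] [DiscreteTopology T]

/-- the universal `F_σδ` set -/
def R0 (t0 : T) : Set (ℕ → T) := {z | ∀ n, ∀ᶠ j in atTop, z (Nat.pair n j) = t0}

theorem row_iff (t0 : T) (z : ℕ → T) (n : ℕ) : (∀ᶠ j in atTop, z (Nat.pair n j) = t0) ↔
    ∃ J, ∀ j ≥ J, (Nat.unpair j).1 = n → z j = t0 := by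
  rw [eventually_atTop]
  constructor
  · rintro ⟨I, hI⟩
    refine ⟨Nat.pair n I, fun j hj hn => ?_⟩
    have h1 : Nat.pair n (Nat.unpair j).2 = j := by rw [← hn]; exact Nat.pair_unpair j
    rw [← h1]
    apply hI
    by_contra hcon
    push Not at hcon
    have := Nat.pair_lt_pair_right n hcon
    omega
  · rintro ⟨J, hJ⟩
    refine ⟨J, fun j hj => hJ _ (hj.trans (Nat.right_le_pair n j)) (by simp)⟩

theorem ev_eq {Y D : Type*} [TopologicalSpace Y] [TopologicalSpace D] [DiscreteTopology D]
    {g : Y → D} (hg : Continuous g) (y : Y) : ∀ᶠ y' in 𝓝 y, g y' = g y :=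
  ((isOpen_discrete {g y}).preimage hg).mem_nhds rfl

theorem cont_of_ev {Y D : Type*} [TopologicalSpace Y] [TopologicalSpace D]
    {g : Y → D} (hg : ∀ y, ∀ᶠ y' in 𝓝 y, g y' = g y) : Continuous g := by
  rw [continuous_iff_continuousAt]
  intro y
  have : g =ᶠ[𝓝 y] fun _ => g y := hg y
  exact continuousAt_const.congr this.symm

theorem nested_point (U : ℕ → Set (ℕ → T)) (hc : ∀ j, IsClosed (U j)) (hne : ∀ j, (U j).Nonempty)
    (hd : ∀ j, U (j+1) ⊆ U j) (hs : ∀ j, SmallN j (U j)) : ∃ x, ∀ j, x ∈ U j := by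
  choose p hp using hne
  have hanti : Antitone U := antitone_nat_of_succ_le hd
  refine ⟨fun i => p (i+1) i, fun j => ?_⟩
  rw [← (hc j).closure_eq, mem_closure_iff]
  intro O hO hx
  obtain ⟨n, hjn, hn⟩ := exists_cyl_subset hO hx j
  refine ⟨p n, hn fun i hi => ?_, hanti hjn (hp n)⟩
  exact hs (i+1) _ (hanti hi (hp n)) _ (hp (i+1)) i i.lt_succ_self

structure St (T : Type u) where
  U : Set (ℕ → T)
  R : ℕ
  E : ℕ → Set (ℕ → T)
  n : ℕ → ℕ

structure St.Valid (k : Cardinal.{u}) (XB : Set (ℕ → T)) (Xc : ℕ → ℕ → Set (ℕ → T)) (j : ℕ)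
    (s : St T) : Prop where
  clop : IsClopen s.U
  small : SmallN j s.U
  anti : ∀ i < s.R, s.E (i+1) ⊆ s.E i
  good : ∀ i ≤ s.R, Good k XB Xc (s.n i) (s.E i)
  sub : ∀ i ≤ s.R, s.E i ⊆ s.U
  ne : (s.E s.R).Nonempty
  cl : ∀ i < s.R, closure (s.E (i+1)) ⊆ ⋃ m, Xc i m

/-- transition relation between states -/
structure Trans (t0 : T) (Xc : ℕ → ℕ → Set (ℕ → T)) (j : ℕ) (t : T) (s s' : St T) : Prop where
  sub : s'.U ⊆ s.U
  caseA : (t = t0 ∨ s.R < (Nat.unpair j).1) → s'.R = s.R + 1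
  caseB : ¬ (t = t0 ∨ s.R < (Nat.unpair j).1) → s'.R = (Nat.unpair j).1 ∧
    Disjoint s'.U (Xc (s.n (Nat.unpair j).1) j)
  keep : ∀ i ≤ s.R, i ≤ s'.R → s'.E i ⊆ s.E i ∧ s'.n i = s.n i

theorem St.Valid.mono {k : Cardinal.{u}} {XB : Set (ℕ → T)} {Xc : ℕ → ℕ → Set (ℕ → T)} {j : ℕ}
    {s : St T} (h : s.Valid k XB Xc j) {i : ℕ} (hi : i ≤ s.R) : s.E s.R ⊆ s.E i := by
  have : ∀ d, i + d ≤ s.R → s.E (i + d) ⊆ s.E i := by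
    intro d
    induction d with
    | zero => intro _; exact Subset.rfl
    | succ d ih => intro hd; exact (h.anti (i + d) hd).trans (ih (by omega))
  have := this (s.R - i) (by omega)
  rwa [Nat.add_sub_cancel' hi] at this

theorem smallN_inter_cyl {j m : ℕ} (h : j ≤ m) (S : Set (ℕ → T)) (x : ℕ → T) :
    SmallN j (S ∩ PiNat.cylinder x m) := by
  intro a ha b hb i hi
  exact (ha.2 i (hi.trans_le h)).trans (hb.2 i (hi.trans_le h)).symm

theorem step_H {k : Cardinal.{u}} (hT : TCase k T) (t0 : T) {XB : Set (ℕ → T)}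
    {Xc : ℕ → ℕ → Set (ℕ → T)}
    (hXc : ∀ n m, IsClosed (Xc n m)) (hX : XB = ⋂ n, ⋃ m, Xc n m) (j : ℕ) (s : St T)
    (hs : s.Valid k XB Xc j) :
    ∃ (g : (ℕ → T) → T) (ch : T → St T), Continuous g ∧ ∀ t, (ch t).Valid k XB Xc (j+1) ∧
      (∀ x ∈ (ch t).U, g x = t) ∧ Trans t0 Xc j t s (ch t) := by
  classical
  obtain ⟨g, hg, hgs⟩ := splitD hT (s.E s.R) hs.ne (fun V hV hne hw =>
    ((hs.good _ le_rfl).2 V hV hne).1 (small_weight hw))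
  have key : ∀ t, ∃ s' : St T, s'.Valid k XB Xc (j+1) ∧
      (∀ x ∈ s'.U, g x = t) ∧ Trans t0 Xc j t s s' := by
    intro t
    obtain ⟨x, hxE, hxt⟩ := hgs t
    set V0 := s.U ∩ {x | g x = t} with hV0
    have hV0c : IsClopen V0 := hs.clop.inter ((isClopen_discrete {t}).preimage hg)
    have hxV0 : x ∈ V0 := ⟨hs.sub _ le_rfl hxE, hxt⟩
    by_cases hcase : t = t0 ∨ s.R < (Nat.unpair j).1
    · set V := V0 ∩ PiNat.cylinder x (j+1) with hV
      have hVc : IsClopen V := hV0c.inter (isClopen_cyl _ _)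
      have hne : (s.E s.R ∩ V).Nonempty := ⟨x, hxE, hxV0, PiNat.self_mem_cylinder _ _⟩
      have hns := ((hs.good _ le_rfl).2 V hVc hne).1
      have hEX : s.E s.R ⊆ XB := (hs.good _ le_rfl).1
      have : ∃ m, ¬ Small k XB (s.E s.R ∩ V ∩ Xc s.R m) := by
        by_contra hcon
        push Not at hcon
        refine hns (small_mono ?_ (small_iUnion hcon))
        intro y hy
        have := hEX hy.1
        rw [hX] at this
        obtain ⟨m, hm⟩ := mem_iUnion.1 (mem_iInter.1 this s.R)
        exact mem_iUnion.2 ⟨m, hy, hm⟩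
      obtain ⟨m, hm⟩ := this
      obtain ⟨n', E', hE', hne', hgood'⟩ := lemmaK hXc hX
        ((inter_subset_left.trans inter_subset_left).trans hEX) hm
      refine ⟨⟨V, s.R + 1, fun i => if i ≤ s.R then s.E i ∩ V else E',
        fun i => if i ≤ s.R then s.n i else n'⟩, ⟨hVc, smallN_inter_cyl le_rfl _ _, ?_, ?_, ?_, ?_,
        ?_⟩, fun y hy => hy.1.2, ⟨fun y hy => hy.1.1, fun _ => rfl, fun h => absurd hcase h, ?_⟩⟩
      · intro i hi
        simp only at hi ⊢
        rcases Nat.lt_succ_iff_lt_or_eq.1 hi with h | rfl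
        · rw [if_pos (Nat.succ_le_of_lt h), if_pos h.le]
          exact inter_subset_inter_left _ (hs.anti i h)
        · rw [if_neg (by omega), if_pos le_rfl]
          exact hE'.trans inter_subset_left
      · intro i hi
        simp only at hi ⊢
        by_cases h : i ≤ s.R
        · rw [if_pos h, if_pos h]; exact good_inter (hs.good i h) hVc
        · rw [if_neg h, if_neg h]; exact hgood'
      · intro i hi
        simp only at hi ⊢
        by_cases h : i ≤ s.R
        · rw [if_pos h]; exact inter_subset_right
        · rw [if_neg h]; exact hE'.trans (inter_subset_left.trans inter_subset_right)
      · simpa using hne'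
      · intro i hi
        simp only at hi ⊢
        rcases Nat.lt_succ_iff_lt_or_eq.1 hi with h | rfl
        · rw [if_pos (Nat.succ_le_of_lt h)]
          exact (closure_mono inter_subset_left).trans (hs.cl i h)
        · rw [if_neg (by omega)]
          exact (closure_minimal (hE'.trans inter_subset_right) (hXc _ _)).trans
            (subset_iUnion _ m)
      · intro i hi _
        simp only [if_pos hi]
        exact ⟨inter_subset_left, trivial⟩
    · have hr : (Nat.unpair j).1 ≤ s.R := by
        push Not at hcase; exact hcase.2
      set r := (Nat.unpair j).1 with hrdef
      have hne : (s.E r ∩ V0).Nonempty := ⟨x, hs.mono hr hxE, hxV0⟩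
      have := ((hs.good r hr).2 V0 hV0c hne).2 j
      obtain ⟨y, ⟨hyE, hyV0⟩, hyX⟩ := not_subset.1 this
      obtain ⟨m, hm, hmX⟩ := exists_cyl_subset (hXc (s.n r) j).isOpen_compl hyX (j+1)
      set V := V0 ∩ PiNat.cylinder y m with hV
      have hVc : IsClopen V := hV0c.inter (isClopen_cyl _ _)
      refine ⟨⟨V, r, fun i => s.E i ∩ V, s.n⟩, ⟨hVc, smallN_inter_cyl hm _ _, ?_, ?_, ?_, ?_,
        ?_⟩, fun y hy => hy.1.2, ⟨fun y hy => hy.1.1, fun h => absurd h hcase,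
          fun h => ⟨rfl, ?_⟩, ?_⟩⟩
      · exact fun i hi => inter_subset_inter_left _ (hs.anti i (lt_of_lt_of_le hi hr))
      · exact fun i hi => good_inter (hs.good i (le_trans hi hr)) hVc
      · exact fun i hi => inter_subset_right
      · exact ⟨y, hyE, hyV0, PiNat.self_mem_cylinder _ _⟩
      · exact fun i hi => (closure_mono inter_subset_left).trans (hs.cl i (lt_of_lt_of_le hi hr))
      · exact disjoint_left.2 fun z hz hz' => hmX hz.2 hz'
      · exact fun i _ _ => ⟨inter_subset_left, rfl⟩
  choose ch hch using key
  exact ⟨g, ch, hg, hch⟩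

theorem trans_stable {t0 : T} {Xc : ℕ → ℕ → Set (ℕ → T)} (z : ℕ → T) (st : ℕ → St T)
    (htr : ∀ j, Trans t0 Xc j (z j) (st j) (st (j+1))) (r : ℕ)
    (hz : ∀ i < r, ∃ J, ∀ j ≥ J, (Nat.unpair j).1 = i → z j = t0) :
    ∃ J, (∀ j ≥ J, r ≤ (st j).R) ∧
      ∀ j ≥ J, ∀ i ≤ r, (st j).E i ⊆ (st J).E i ∧ (st j).n i = (st J).n i := by
  have h0 : ∃ J, ∀ j ≥ J, (Nat.unpair j).1 < r → z j = t0 := by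
    clear htr
    induction r with
    | zero => exact ⟨0, fun j _ h => absurd h (Nat.not_lt_zero _)⟩
    | succ r ih =>
      obtain ⟨J, hJ⟩ := ih fun i hi => hz i (hi.trans r.lt_succ_self)
      obtain ⟨J', hJ'⟩ := hz r r.lt_succ_self
      refine ⟨max J J', fun j hj hr => ?_⟩
      rcases Nat.lt_succ_iff_lt_or_eq.1 hr with h | h
      · exact hJ j ((le_max_left _ _).trans hj) h
      · exact hJ' j ((le_max_right _ _).trans hj) h
  obtain ⟨J, hJ⟩ := h0
  have h1 : ∀ i, min r i ≤ (st (J + i)).R := by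
    intro i
    induction i with
    | zero => simp
    | succ i ih =>
      have := htr (J + i)
      by_cases hc : z (J + i) = t0 ∨ (st (J+i)).R < (Nat.unpair (J+i)).1
      · have := this.caseA hc
        rw [← Nat.add_assoc, this]; omega
      · have h2 := (this.caseB hc).1
        have h3 : ¬ (Nat.unpair (J+i)).1 < r := fun h => hc (Or.inl (hJ _ (by omega) h))
        rw [← Nat.add_assoc, h2]; omega
  have h2 : ∀ j ≥ J + r, r ≤ (st j).R := by
    intro j hj
    have := h1 (j - J)
    rw [Nat.add_sub_cancel' (by omega)] at this
    omega
  refine ⟨J + r, h2, fun j hj i hi => ?_⟩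
  induction j, hj using Nat.le_induction with
  | base => exact ⟨Subset.rfl, rfl⟩
  | succ j hj ih =>
    have := (htr j).keep i (hi.trans (h2 j hj)) (hi.trans (h2 (j+1) (by omega)))
    exact ⟨this.1.trans ih.1, this.2.trans ih.2⟩

theorem lemmaH {k : Cardinal.{u}} (hT : TCase k T) (t0 : T) {XB : Set (ℕ → T)}
    {Xc : ℕ → ℕ → Set (ℕ → T)}
    (hXc : ∀ n m, IsClosed (Xc n m)) (hmono : ∀ n, Monotone (Xc n))
    (hX : XB = ⋂ n, ⋃ m, Xc n m) (Q : Set (ℕ → T)) (hQ : IsClopen Q)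
    (hns : ¬ Small k XB (XB ∩ Q)) :
    ∃ e : (ℕ → T) → ℕ → T, IsClosedEmbedding e ∧ range e ⊆ Q ∧ e ⁻¹' XB = R0 t0 := by
  classical
  obtain ⟨n0, E0, hE0, hE0ne, hE0g⟩ := lemmaK hXc hX inter_subset_left hns
  let s0 : St T := ⟨Q, 0, fun _ => E0, fun _ => n0⟩
  have hs0 : s0.Valid k XB Xc 0 := by
    refine ⟨hQ, fun _ _ _ _ i hi => absurd hi (Nat.not_lt_zero i), ?_, fun _ _ => hE0g,
      fun _ _ => hE0.trans inter_subset_right, hE0ne, ?_⟩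
    · exact fun i hi => absurd hi (Nat.not_lt_zero i)
    · exact fun i hi => absurd hi (Nat.not_lt_zero i)
  have key : ∀ (s : St T) (j : ℕ), ∃ (g : (ℕ → T) → T) (ch : T → St T), s.Valid k XB Xc j →
      Continuous g ∧ ∀ t, (ch t).Valid k XB Xc (j+1) ∧
      (∀ x ∈ (ch t).U, g x = t) ∧ Trans t0 Xc j t s (ch t) := by
    intro s j
    by_cases h : s.Valid k XB Xc j
    · obtain ⟨g, ch, h1, h2⟩ := step_H hT t0 hXc hX j s h
      exact ⟨g, ch, fun _ => ⟨h1, h2⟩⟩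
    · exact ⟨fun _ => t0, fun _ => s, fun h' => absurd h' h⟩
  choose g ch hg using key
  let st : (ℕ → T) → ℕ → St T := fun z j => Nat.rec s0 (fun j s => ch s j (z j)) j
  have st_succ : ∀ z j, st z (j+1) = ch (st z j) j (z j) := fun _ _ => rfl
  have hv : ∀ z j, (st z j).Valid k XB Xc j := by
    intro z j
    induction j with
    | zero => exact hs0
    | succ j ih => exact ((hg _ j ih).2 (z j)).1
  have htr : ∀ z j, Trans t0 Xc j (z j) (st z j) (st z (j+1)) := fun z j =>
    ((hg _ j (hv z j)).2 (z j)).2.2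
  have hgz : ∀ z j, ∀ x ∈ (st z (j+1)).U, g (st z j) j x = z j := fun z j =>
    ((hg _ j (hv z j)).2 (z j)).2.1
  have hpt : ∀ z, ∃ x, ∀ j, x ∈ (st z j).U := fun z =>
    nested_point _ (fun j => (hv z j).clop.isClosed)
      (fun j => (hv z j).ne.mono ((hv z j).sub _ le_rfl)) (fun j => (htr z j).sub)
      (fun j => (hv z j).small)
  choose e he using hpt
  have st_congr : ∀ z z' j, z' ∈ PiNat.cylinder z j → st z' j = st z j := by
    intro z z' j
    induction j with
    | zero => intro _; rfl
    | succ j ih =>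
      intro h
      rw [st_succ, st_succ, ih (PiNat.cylinder_anti z j.le_succ h), h j j.lt_succ_self]
  have hec : Continuous e := by
    refine continuous_pi fun i => continuous_of_cyl _ fun z => ⟨i+1, fun z' hz' => ?_⟩
    have h1 := he z' (i+1)
    rw [st_congr z z' _ hz'] at h1
    exact (hv z (i+1)).small _ h1 _ (he z (i+1)) i i.lt_succ_self
  let sy : (ℕ → T) → ℕ → St T := fun y j => Nat.rec s0 (fun j s => ch s j (g s j y)) j
  have sy_succ : ∀ y j, sy y (j+1) = ch (sy y j) j (g (sy y j) j y) := fun _ _ => rfl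
  have hvy : ∀ z j, (sy z j).Valid k XB Xc j := by
    intro z j
    induction j with
    | zero => exact hs0
    | succ j ih => exact ((hg _ j ih).2 _).1
  have hsyc : ∀ y j, ∀ᶠ y' in 𝓝 y, sy y' j = sy y j := by
    intro y j
    induction j with
    | zero => exact Eventually.of_forall fun _ => rfl
    | succ j ih =>
      have h1 : ∀ᶠ y' in 𝓝 y, g (sy y j) j y' = g (sy y j) j y :=
        ev_eq (hg _ j (hvy y j)).1 y
      filter_upwards [ih, h1] with y' h2 h3
      rw [sy_succ, sy_succ, h2, h3]
  let l : (ℕ → T) → ℕ → T := fun y j => g (sy y j) j y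
  have hlc : Continuous l := by
    refine continuous_pi fun j => ?_
    rw [continuous_iff_continuousAt]
    intro y
    have h1 : ∀ᶠ y' in 𝓝 y, g (sy y j) j y' = g (sy y j) j y :=
      ev_eq (hg _ j (hvy y j)).1 y
    have : (fun y' => l y' j) =ᶠ[𝓝 y] fun _ => l y j := by
      filter_upwards [hsyc y j, h1] with y' h2 h3
      simp only [l, h2, h3]
    exact continuousAt_const.congr this.symm
  have hsy : ∀ z j, sy (e z) j = st z j := by
    intro z j
    induction j with
    | zero => rfl
    | succ j ih => rw [sy_succ, st_succ, ih, hgz z j _ (he z (j+1))]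
  have hl : Function.LeftInverse l e := by
    intro z
    funext j
    simp only [l, hsy]
    exact hgz z j _ (he z (j+1))
  refine ⟨e, hl.isClosedEmbedding hlc hec, ?_, ?_⟩
  · rintro _ ⟨z, rfl⟩
    exact he z 0
  · ext z
    rw [mem_preimage]
    have hR0 : z ∈ R0 t0 ↔ ∀ n, ∃ J, ∀ j ≥ J, (Nat.unpair j).1 = n → z j = t0 :=
      forall_congr' fun n => row_iff t0 z n
    rw [hR0]
    constructor
    · intro hzX
      by_contra hcon
      push Not at hcon
      let r := Nat.find hcon
      have hr := Nat.find_spec hcon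
      have hlt : ∀ i < r, ∃ J, ∀ j ≥ J, (Nat.unpair j).1 = i → z j = t0 := by
        intro i hi
        have := Nat.find_min hcon hi
        push Not at this
        exact this
      obtain ⟨J, hJ1, hJ2⟩ := trans_stable z (st z) (htr z) r hlt
      rw [hX] at hzX
      obtain ⟨m, hm⟩ := mem_iUnion.1 (mem_iInter.1 hzX ((st z J).n r))
      obtain ⟨j, hj, hjr, hjz⟩ := hr (max J m)
      have h1 : (Nat.unpair j).1 = r := hjr
      have h2 := (htr z j).caseB (by
        rw [h1]
        have := hJ1 j ((le_max_left _ _).trans hj)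
        rintro (h | h)
        · exact hjz h
        · omega)
      have h3 := (hJ2 j ((le_max_left _ _).trans hj) r le_rfl).2
      rw [h1, h3] at h2
      exact disjoint_left.1 h2.2 (he z (j+1)) (hmono _ ((le_max_right _ _).trans hj) hm)
    · intro hz
      rw [hX, mem_iInter]
      intro r
      obtain ⟨J, hJ1, hJ2⟩ := trans_stable z (st z) (htr z) (r+1) fun i _ => hz i
      refine (hv z J).cl r (hJ1 J le_rfl) ?_
      rw [mem_closure_iff]
      intro O hO hx
      obtain ⟨n, hn, hs⟩ := exists_cyl_subset hO hx J
      have h1 := hJ1 n hn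
      obtain ⟨p, hp⟩ := (hv z n).ne
      have hpE := (hv z n).mono h1 hp
      refine ⟨p, hs fun i hi => ?_, (hJ2 n hn (r+1) le_rfl).1 hpE⟩
      exact (hv z n).small _ ((hv z n).sub _ h1 hpE) _ (he z n) i hi

end MK
end

section
set_option linter.unusedSectionVars false
set_option linter.unusedSimpArgs false
namespace MK

variable {T : Type u} [TopologicalSpace T] [DiscreteTopology T]

theorem fsd_data {Y : Type*} [TopologicalSpace Y] {A : Set Y} (hA : IsFsigmaDelta A) :
    ∃ F : ℕ → ℕ → Set Y, (∀ n m, IsClosed (F n m)) ∧ (∀ n, Monotone (F n)) ∧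
      A = ⋂ n, ⋃ m, F n m := by
  obtain ⟨F, hF, rfl⟩ := hA
  choose G hG hGe using hF
  refine ⟨fun n m => ⋃ i ∈ Finset.range (m+1), G n i, fun n m => ?_, fun n a b hab => ?_, ?_⟩
  · exact isClosed_biUnion_finset fun i _ => hG n i
  · refine biUnion_subset_biUnion_left ?_
    intro i hi
    simp only [Finset.coe_range, Finset.mem_range, SetLike.mem_coe, mem_Iio] at hi ⊢
    exact hi.trans_le (Nat.succ_le_succ hab)
  · congr 1
    funext n
    rw [hGe]
    ext x
    simp only [mem_iUnion, Finset.mem_range]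
    exact ⟨fun ⟨i, hi⟩ => ⟨i, i, i.lt_succ_self, hi⟩, fun ⟨m, i, _, hi⟩ => ⟨i, hi⟩⟩

/-- the modulus -/
noncomputable def mu (F : ℕ → Set (ℕ → T)) (x : ℕ → T) (i : ℕ) : ℕ :=
  sInf {m | i ≤ m ∨ (F m ∩ PiNat.cylinder x i).Nonempty}

theorem mu_mem (F : ℕ → Set (ℕ → T)) (x : ℕ → T) (i : ℕ) :
    i ≤ mu F x i ∨ (F (mu F x i) ∩ PiNat.cylinder x i).Nonempty :=
  Nat.sInf_mem (s := {m | i ≤ m ∨ (F m ∩ PiNat.cylinder x i).Nonempty}) ⟨i, Or.inl le_rfl⟩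

theorem mu_le (F : ℕ → Set (ℕ → T)) (x : ℕ → T) (i m : ℕ)
    (h : i ≤ m ∨ (F m ∩ PiNat.cylinder x i).Nonempty) : mu F x i ≤ m :=
  Nat.sInf_le h

theorem mu_mono (F : ℕ → Set (ℕ → T)) (x : ℕ → T) : Monotone (mu F x) := by
  refine monotone_nat_of_le_succ fun i => mu_le F x i _ ?_
  rcases mu_mem F x (i+1) with h | h
  · exact Or.inl ((Nat.le_succ i).trans h)
  · exact Or.inr (h.mono (inter_subset_inter_right _ (PiNat.cylinder_anti x i.le_succ)))

theorem mu_ev (F : ℕ → Set (ℕ → T)) (hF : ∀ m, IsClosed (F m)) (x : ℕ → T) :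
    (∃ J, ∀ i ≥ J, mu F x (i+1) = mu F x i) ↔ x ∈ ⋃ m, F m := by
  constructor
  · rintro ⟨J, hJ⟩
    have h1 : ∀ i ≥ J, mu F x i = mu F x J := by
      intro i hi
      induction i, hi using Nat.le_induction with
      | base => rfl
      | succ i hi ih => rw [hJ i hi, ih]
    refine mem_iUnion.2 ⟨mu F x J, ?_⟩
    rw [← (hF _).closure_eq, mem_closure_iff]
    intro O hO hx
    obtain ⟨n, hn, hs⟩ := exists_cyl_subset hO hx (max J (mu F x J + 1))
    have h2 := h1 n ((le_max_left _ _).trans hn)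
    have h3 := (le_max_right _ _).trans hn
    rcases mu_mem F x n with h | ⟨p, hp⟩
    · omega
    · rw [h2] at hp
      exact ⟨p, hs hp.2, hp.1⟩
  · intro hx
    obtain ⟨m, hm⟩ := mem_iUnion.1 hx
    have hb : ∀ i, mu F x i ≤ m := fun i =>
      mu_le F x i m (Or.inr ⟨x, hm, PiNat.self_mem_cylinder _ _⟩)
    obtain ⟨J, hJ⟩ := WellFoundedGT.monotone_chain_condition
      (⟨fun i => (⟨mu F x i, Nat.lt_succ_of_le (hb i)⟩ : Fin (m+1)),
        fun a b h => mu_mono F x h⟩ : ℕ →o Fin (m+1))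
    refine ⟨J, fun i hi => ?_⟩
    have h1 := hJ i hi
    have h2 := hJ (i+1) (by omega)
    have := congrArg Fin.val (h2.symm.trans h1)
    exact this

theorem mu_congr (F : ℕ → Set (ℕ → T)) (x y : ℕ → T) (i : ℕ) (h : y ∈ PiNat.cylinder x i) :
    mu F y i = mu F x i := by
  rw [mu, mu, PiNat.mem_cylinder_iff_eq.1 h]

open Classical in
noncomputable def rho (t0 t1 : T) (F : ℕ → ℕ → Set (ℕ → T)) (x : ℕ → T) (p : ℕ) : T :=
  match (Nat.unpair p).2 with
  | 0 => x (Nat.unpair p).1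
  | 1 => t0
  | i + 2 => if mu (F (Nat.unpair p).1) x (i+1) = mu (F (Nat.unpair p).1) x i then t0 else t1

theorem lemmaR (t0 t1 : T) (h01 : t0 ≠ t1) (A : Set (ℕ → T)) (hA : IsFsigmaDelta A) :
    ∃ f : (ℕ → T) → ℕ → T, IsClosedEmbedding f ∧ interior (range f) = ∅ ∧ f ⁻¹' (R0 t0) = A := by
  classical
  obtain ⟨F, hF, -, rfl⟩ := fsd_data hA
  have e0 : ∀ x n, rho t0 t1 F x (Nat.pair n 0) = x n := by
    intro x n; simp [rho]
  have e1 : ∀ x n, rho t0 t1 F x (Nat.pair n 1) = t0 := by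
    intro x n; simp [rho]
  have e2 : ∀ x n i, rho t0 t1 F x (Nat.pair n (i+2)) =
      if mu (F n) x (i+1) = mu (F n) x i then t0 else t1 := by
    intro x n i; simp [rho]
  have hc : Continuous (rho t0 t1 F) := by
    refine continuous_pi fun p => continuous_of_cyl _ fun x => ?_
    obtain ⟨n, j, rfl⟩ : ∃ n j, p = Nat.pair n j := ⟨_, _, (Nat.pair_unpair p).symm⟩
    match j with
    | 0 => exact ⟨n+1, fun y hy => by rw [e0, e0]; exact hy n n.lt_succ_self⟩
    | 1 => exact ⟨0, fun y hy => by rw [e1, e1]⟩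
    | i + 2 =>
      refine ⟨i+1, fun y hy => ?_⟩
      rw [e2, e2, mu_congr _ x y (i+1) hy, mu_congr _ x y i (PiNat.cylinder_anti x i.le_succ hy)]
  have hl : Function.LeftInverse (fun (z : ℕ → T) n => z (Nat.pair n 0)) (rho t0 t1 F) := by
    intro x; funext n; exact e0 x n
  refine ⟨rho t0 t1 F, hl.isClosedEmbedding (continuous_pi fun n => continuous_apply _) hc, ?_, ?_⟩
  · rw [eq_empty_iff_forall_notMem]
    intro z hz
    obtain ⟨L, -, hL⟩ := exists_cyl_subset isOpen_interior hz 0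
    have h1 : Function.update z (Nat.pair L 1) t1 ∈ PiNat.cylinder z L := by
      intro i hi
      rw [Function.update_of_ne]
      have := Nat.left_le_pair L 1
      omega
    obtain ⟨x, hx⟩ := interior_subset (hL h1)
    have h2 := e1 x L
    rw [hx, Function.update_self] at h2
    exact h01 h2.symm
  · ext x
    rw [mem_preimage, mem_iInter]
    refine forall_congr' fun n => ?_
    rw [← mu_ev (F n) (hF n) x, eventually_atTop]
    constructor
    · rintro ⟨J, hJ⟩
      refine ⟨J, fun i hi => ?_⟩
      have := hJ (i+2) (by omega)
      rw [e2] at this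
      by_contra hcon
      rw [if_neg hcon] at this
      exact h01 this.symm
    · rintro ⟨J, hJ⟩
      refine ⟨J + 2, fun j hj => ?_⟩
      obtain ⟨i, rfl⟩ : ∃ i, j = i + 2 := ⟨j - 2, by omega⟩
      rw [e2, if_pos (hJ i (by omega))]

/-- universality for `F_σδ` sets -/
def Univ (X' : Set (ℕ → T)) : Prop := ∀ A, IsFsigmaDelta A → ∀ Q : Set (ℕ → T), IsClopen Q →
  Q.Nonempty → ∃ f : (ℕ → T) → ℕ → T, IsClosedEmbedding f ∧ range f ⊆ Q ∧
    interior (range f) = ∅ ∧ f ⁻¹' X' = A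

theorem univ_of_R0 (t0 t1 : T) (h01 : t0 ≠ t1) (X' : Set (ℕ → T))
    (h : ∀ Q : Set (ℕ → T), IsClopen Q → Q.Nonempty → ∃ e : (ℕ → T) → ℕ → T,
      IsClosedEmbedding e ∧ range e ⊆ Q ∧ e ⁻¹' X' = R0 t0) : Univ X' := by
  intro A hA Q hQ hne
  obtain ⟨e, he, heQ, heX⟩ := h Q hQ hne
  obtain ⟨f, hf, hfi, hfA⟩ := lemmaR t0 t1 h01 A hA
  refine ⟨e ∘ f, he.comp hf, (range_comp_subset_range f e).trans heQ, ?_, ?_⟩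
  · rw [eq_empty_iff_forall_notMem]
    intro z hz
    have h1 : e ⁻¹' interior (range (e ∘ f)) ⊆ interior (range f) := by
      refine interior_maximal ?_ (isOpen_interior.preimage he.continuous)
      intro x hx
      obtain ⟨y, hy⟩ := interior_subset hx
      exact ⟨y, he.injective hy⟩
    obtain ⟨y, hy⟩ := interior_subset hz
    have : f y ∈ interior (range f) := h1 (by rw [mem_preimage]; rw [← hy] at hz; exact hz)
    rw [hfi] at this
    exact this
  · rw [preimage_comp, heX, hfA]

end MK
end

section
set_option linter.unusedSectionVars false
set_option linter.unusedSimpArgs false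
namespace MK

variable {T : Type u} [TopologicalSpace T] [DiscreteTopology T]

theorem half {P Zp : Set (ℕ → T)} (hP : IsClopen P) (hPne : P.Nonempty) (hZ : IsClosed Zp)
    {a : (ℕ → T) → ℕ → T} (ha : IsClosedEmbedding a)
    (hint : interior (a '' Zp) = ∅) (haP : ∀ z ∈ Zp, a z ∈ P)
    {V : Type*} [TopologicalSpace V] [DiscreteTopology V] [Nonempty V]
    (v : (ℕ → T) → V) (hv : Continuous v) (π : V → T) (n : ℕ) (hπ : ∀ z, a z n = π (v z)) :
    ∃ (M : Set (ℕ → T)) (w : (ℕ → T) → V), IsClopen M ∧ Continuous w ∧ M ⊆ P ∧ (P \ M).Nonempty ∧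
      (∀ z ∈ Zp, a z ∈ M ∧ w (a z) = v z) ∧ ∀ x ∈ M, x n = π (w x) ∧ ∃ z ∈ Zp, w x = v z := by
  classical
  rcases Zp.eq_empty_or_nonempty with rfl | hne
  · refine ⟨∅, fun _ => Classical.arbitrary V, isClopen_empty, continuous_const, empty_subset _,
      by simpa using hPne, fun z hz => absurd hz (notMem_empty z), fun z hz =>
      absurd hz (notMem_empty z)⟩
  · have hC : IsClosed (a '' Zp) := ha.isClosedMap _ hZ
    obtain ⟨r, hr1, hr2, hr3⟩ := PiNat.exists_retraction_of_isClosed hC (hne.image a)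
    let h : (ℕ → T) ≃ₜ range a := ha.isEmbedding.toHomeomorph
    have hrm : ∀ x, r x ∈ a '' Zp := fun x => by rw [← hr2]; exact ⟨x, rfl⟩
    let σ : (ℕ → T) → ℕ → T := fun x => h.symm ⟨r x, image_subset_range _ _ (hrm x)⟩
    have hσc : Continuous σ := h.symm.continuous.comp (hr3.subtype_mk _)
    have haσ : ∀ x, a (σ x) = r x := by
      intro x
      have : h (σ x) = ⟨r x, image_subset_range _ _ (hrm x)⟩ := h.apply_symm_apply _
      exact congrArg Subtype.val this
    have hσZ : ∀ x, σ x ∈ Zp := by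
      intro x
      obtain ⟨z, hz, hza⟩ := hrm x
      have : σ x = z := ha.injective ((haσ x).trans hza.symm)
      rw [this]; exact hz
    have hσa : ∀ z ∈ Zp, σ (a z) = z := by
      intro z hz
      refine ha.injective ?_
      rw [haσ, hr1 _ ⟨z, hz, rfl⟩]
    have : ∃ x ∈ P, x ∉ a '' Zp := by
      by_contra hcon
      push Not at hcon
      have := interior_maximal hcon hP.isOpen
      rw [hint] at this
      obtain ⟨x, hx⟩ := hPne
      exact this hx
    obtain ⟨x, hxP, hxa⟩ := this
    obtain ⟨L, -, hL⟩ := exists_cyl_subset hC.isOpen_compl hxa 0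
    have hwc : Continuous (fun x => v (σ x)) := hv.comp hσc
    have hE : IsClopen {y : ℕ → T | y n = π (v (σ y))} := by
      have h1 : Continuous (fun y : ℕ → T => (y n, π (v (σ y)))) :=
        (continuous_apply n).prodMk
          ((continuous_of_discreteTopology (f := π)).comp hwc)
      exact (isClopen_discrete {p : T × T | p.1 = p.2}).preimage h1
    refine ⟨P ∩ {y | y n = π (v (σ y))} ∩ (PiNat.cylinder x L)ᶜ, fun x => v (σ x),
      (hP.inter hE).inter (isClopen_cyl _ _).compl, hwc, fun y hy => hy.1.1,
      ⟨x, hxP, fun hx => hx.2 (PiNat.self_mem_cylinder _ _)⟩, ?_, ?_⟩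
    · intro z hz
      refine ⟨⟨⟨haP z hz, ?_⟩, fun hc => hL hc ⟨z, hz, rfl⟩⟩, ?_⟩
      · show a z n = π (v (σ (a z)))
        rw [hσa z hz]; exact hπ z
      · show v (σ (a z)) = v z
        rw [hσa z hz]
    · rintro y ⟨⟨-, hy⟩, -⟩
      exact ⟨hy, σ y, hσZ y, rfl⟩

structure Nd (T : Type u) where
  P : Set (ℕ → T)
  Q : Set (ℕ → T)
  Z : Set (ℕ → T)
  a : (ℕ → T) → ℕ → T
  b : (ℕ → T) → ℕ → T
  m : ℕ

structure Nd.Valid (X X' : Set (ℕ → T)) (F G : ℕ → Set (ℕ → T)) (n : ℕ) (ν : Nd T) : Prop where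
  Pc : IsClopen ν.P
  Qc : IsClopen ν.Q
  Pne : ν.P.Nonempty
  Qne : ν.Q.Nonempty
  Ps : SmallN n ν.P
  Qs : SmallN n ν.Q
  Zc : IsClosed ν.Z
  ha : IsClosedEmbedding ν.a
  hb : IsClosedEmbedding ν.b
  hab : ∀ z ∈ ν.Z, (ν.a z ∈ ν.P ↔ ν.b z ∈ ν.Q)
  hmem : ∀ z ∈ ν.Z, ν.a z ∈ ν.P → (ν.a z ∈ X ↔ ν.b z ∈ X')
  ia : interior (ν.a '' ν.Z) = ∅
  ib : interior (ν.b '' ν.Z) = ∅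
  hF : ν.P ∩ F ν.m ⊆ ν.a '' ν.Z
  hG : ν.Q ∩ G ν.m ⊆ ν.b '' ν.Z

theorem fresh {X X' : Set (ℕ → T)} {F G : ℕ → Set (ℕ → T)} (hX : IsFsigmaDelta X)
    (hX' : IsFsigmaDelta X') (hU : Univ X) (hU' : Univ X')
    (hFc : ∀ m, IsClosed (F m)) (hGc : ∀ m, IsClosed (G m))
    (hFi : ∀ m, interior (F m) = ∅) (hGi : ∀ m, interior (G m) = ∅)
    (hFG : ∀ m, F m = ∅ ∨ G m = ∅) (n m : ℕ) {P Q : Set (ℕ → T)}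
    (hP : IsClopen P) (hQ : IsClopen Q) (hPne : P.Nonempty) (hQne : Q.Nonempty)
    (hPs : SmallN n P) (hQs : SmallN n Q) :
    ∃ ν : Nd T, ν.Valid X X' F G n ∧ ν.P = P ∧ ν.Q = Q ∧ ν.m = m := by
  rcases hFG m with h | h
  · obtain ⟨f, hf, hfP, hfi, hfX⟩ := hU X' hX' P hP hPne
    refine ⟨⟨P, Q, G m ∩ Q, f, id, m⟩, ⟨hP, hQ, hPne, hQne, hPs, hQs, (hGc m).inter hQ.isClosed,
      hf, .id, ?_, ?_, ?_, ?_, ?_, ?_⟩, rfl, rfl, rfl⟩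
    · exact fun z hz => ⟨fun _ => hz.2, fun _ => hfP ⟨z, rfl⟩⟩
    · intro z _ _
      show f z ∈ X ↔ z ∈ X'
      rw [← hfX]; rfl
    · exact subset_empty_iff.1 ((interior_mono (image_subset_range _ _)).trans hfi.le)
    · simp only [image_id]
      exact subset_empty_iff.1 ((interior_mono inter_subset_left).trans (hGi m).le)
    · simp only [h, inter_empty]; exact empty_subset _
    · simp only [image_id]; exact fun x hx => ⟨hx.2, hx.1⟩
  · obtain ⟨f, hf, hfP, hfi, hfX⟩ := hU' X hX Q hQ hQne
    refine ⟨⟨P, Q, F m ∩ P, id, f, m⟩, ⟨hP, hQ, hPne, hQne, hPs, hQs, (hFc m).inter hP.isClosed,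
      .id, hf, ?_, ?_, ?_, ?_, ?_, ?_⟩, rfl, rfl, rfl⟩
    · exact fun z hz => ⟨fun _ => hfP ⟨z, rfl⟩, fun _ => hz.2⟩
    · intro z _ _
      show z ∈ X ↔ f z ∈ X'
      rw [← hfX]; rfl
    · simp only [image_id]
      exact subset_empty_iff.1 ((interior_mono inter_subset_left).trans (hFi m).le)
    · exact subset_empty_iff.1 ((interior_mono (image_subset_range _ _)).trans hfi.le)
    · simp only [image_id]; exact fun x hx => ⟨hx.2, hx.1⟩
    · simp only [h, inter_empty]; exact empty_subset _

/-- relation between a node and its child -/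
def Child (F G : ℕ → Set (ℕ → T)) (ν ν' : Nd T) : Prop :=
  (ν'.Z = ν.Z ∧ ν'.a = ν.a ∧ ν'.b = ν.b ∧ ν'.m = ν.m ∧ ∃ z ∈ ν.Z, ν.a z ∈ ν'.P) ∨
  (ν'.m = ν.m + 1 ∧ Disjoint ν'.P (F ν.m) ∧ Disjoint ν'.Q (G ν.m))

theorem cont_ite {Y D : Type*} [TopologicalSpace Y] [TopologicalSpace D] {M : Set Y}
    (hM : IsClopen M) [∀ y, Decidable (y ∈ M)] {f g : Y → D} (hf : Continuous f)
    (hg : Continuous g) : Continuous (fun y => if y ∈ M then f y else g y) := by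
  refine Continuous.if (fun z hz => ?_) hf hg
  have h1 : frontier {z | z ∈ M} = ∅ := hM.frontier_eq
  rw [h1] at hz
  exact absurd hz (notMem_empty z)

theorem step_BF {k : Cardinal.{u}} (hT : TCase k T) {X X' : Set (ℕ → T)} {F G : ℕ → Set (ℕ → T)}
    (hX : IsFsigmaDelta X)
    (hX' : IsFsigmaDelta X') (hU : Univ X) (hU' : Univ X')
    (hFc : ∀ m, IsClosed (F m)) (hGc : ∀ m, IsClosed (G m))
    (hFi : ∀ m, interior (F m) = ∅) (hGi : ∀ m, interior (G m) = ∅)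
    (hFG : ∀ m, F m = ∅ ∨ G m = ∅) (n : ℕ) (ν : Nd T) (hν : ν.Valid X X' F G n) :
    ∃ (p q : (ℕ → T) → (T × T) ⊕ T) (ch : (T × T) ⊕ T → Nd T), Continuous p ∧ Continuous q ∧
      (∀ i, (ch i).P ⊆ ν.P ∧ (ch i).Q ⊆ ν.Q ∧ (∀ x ∈ (ch i).P, p x = i) ∧
        ∀ y ∈ (ch i).Q, q y = i) ∧
      (∀ x ∈ ν.P, x ∈ (ch (p x)).P ∧ (ch (p x)).Valid X X' F G (n+1) ∧ Child F G ν (ch (p x))) ∧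
      (∀ y ∈ ν.Q, y ∈ (ch (q y)).Q ∧ (ch (q y)).Valid X X' F G (n+1) ∧ Child F G ν (ch (q y))) := by
  classical
  have hTne := hT.nonempty
  have hbQ : ∀ z ∈ ν.Z ∩ ν.a ⁻¹' ν.P, ν.b z ∈ ν.Q := fun z hz => (hν.hab z hz.1).1 hz.2
  have hZp : IsClosed (ν.Z ∩ ν.a ⁻¹' ν.P) :=
    hν.Zc.inter (hν.Pc.isClosed.preimage hν.ha.continuous)
  have hvc : Continuous (fun z => (ν.a z n, ν.b z n)) :=
    ((continuous_apply n).comp hν.ha.continuous).prodMk ((continuous_apply n).comp hν.hb.continuous)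
  obtain ⟨M, w, hMc, hwc, hMP, hMne, hM1, hM2⟩ := half hν.Pc hν.Pne hZp hν.ha
    (subset_empty_iff.1 ((interior_mono (image_mono inter_subset_left)).trans hν.ia.le))
    (fun z hz => hz.2) (fun z => (ν.a z n, ν.b z n)) hvc Prod.fst n (fun _ => rfl)
  obtain ⟨M', w', hMc', hwc', hMP', hMne', hM1', hM2'⟩ := half hν.Qc hν.Qne hZp hν.hb
    (subset_empty_iff.1 ((interior_mono (image_mono inter_subset_left)).trans hν.ib.le))
    hbQ (fun z => (ν.a z n, ν.b z n)) hvc Prod.snd n (fun _ => rfl)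
  obtain ⟨g, hgc, hgs, hgd⟩ := splitB hT (ν.P \ M) (hν.Pc.isOpen.sdiff hMc.isClosed) hMne
    (fun x => x n) (continuous_apply n)
  obtain ⟨g', hgc', hgs', hgd'⟩ := splitB hT (ν.Q \ M') (hν.Qc.isOpen.sdiff hMc'.isClosed) hMne'
    (fun x => x n) (continuous_apply n)
  let p : (ℕ → T) → (T × T) ⊕ T := fun x => if x ∈ M then Sum.inl (w x) else Sum.inr (g x)
  let q : (ℕ → T) → (T × T) ⊕ T := fun x => if x ∈ M' then Sum.inl (w' x) else Sum.inr (g' x)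
  have hp : Continuous p := cont_ite hMc (continuous_inl.comp hwc) (continuous_inr.comp hgc)
  have hq : Continuous q := cont_ite hMc' (continuous_inl.comp hwc') (continuous_inr.comp hgc')
  have pl : ∀ x c, p x = Sum.inl c → x ∈ M ∧ w x = c := by
    intro x c h
    by_cases hx : x ∈ M
    · simp only [p, if_pos hx, Sum.inl.injEq] at h; exact ⟨hx, h⟩
    · simp only [p, if_neg hx] at h; cases h
  have pr : ∀ x c, p x = Sum.inr c → x ∉ M ∧ g x = c := by
    intro x c h
    by_cases hx : x ∈ M
    · simp only [p, if_pos hx] at h; cases h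
    · simp only [p, if_neg hx, Sum.inr.injEq] at h; exact ⟨hx, h⟩
  have ql : ∀ x c, q x = Sum.inl c → x ∈ M' ∧ w' x = c := by
    intro x c h
    by_cases hx : x ∈ M'
    · simp only [q, if_pos hx, Sum.inl.injEq] at h; exact ⟨hx, h⟩
    · simp only [q, if_neg hx] at h; cases h
  have qr : ∀ x c, q x = Sum.inr c → x ∉ M' ∧ g' x = c := by
    intro x c h
    by_cases hx : x ∈ M'
    · simp only [q, if_pos hx] at h; cases h
    · simp only [q, if_neg hx, Sum.inr.injEq] at h; exact ⟨hx, h⟩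
  have pM : ∀ z ∈ ν.Z, ν.a z ∈ ν.P → p (ν.a z) = Sum.inl (ν.a z n, ν.b z n) := by
    intro z hz h
    have := hM1 z ⟨hz, h⟩
    simp only [p, if_pos this.1, this.2]
  have qM : ∀ z ∈ ν.Z, ν.b z ∈ ν.Q → q (ν.b z) = Sum.inl (ν.a z n, ν.b z n) := by
    intro z hz h
    have := hM1' z ⟨hz, (hν.hab z hz).2 h⟩
    simp only [q, if_pos this.1, this.2]
  let PP : (T × T) ⊕ T → Set (ℕ → T) := fun i => ν.P ∩ p ⁻¹' {i}
  let QQ : (T × T) ⊕ T → Set (ℕ → T) := fun i => ν.Q ∩ q ⁻¹' {i}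
  have hPPc : ∀ i, IsClopen (PP i) := fun i => hν.Pc.inter ((isClopen_discrete _).preimage hp)
  have hQQc : ∀ i, IsClopen (QQ i) := fun i => hν.Qc.inter ((isClopen_discrete _).preimage hq)
  have hPPs : ∀ i, SmallN (n+1) (PP i) := by
    rintro i x ⟨hx, hxi⟩ y ⟨hy, hyi⟩ j hj
    rcases Nat.lt_succ_iff_lt_or_eq.1 hj with h | rfl
    · exact hν.Ps x hx y hy j h
    · rcases i with c | c
      · obtain ⟨h1, h2⟩ := pl x c hxi
        obtain ⟨h3, h4⟩ := pl y c hyi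
        rw [(hM2 x h1).1, (hM2 y h3).1, h2, h4]
      · obtain ⟨h1, h2⟩ := pr x c hxi
        obtain ⟨h3, h4⟩ := pr y c hyi
        exact hgd x ⟨hx, h1⟩ y ⟨hy, h3⟩ (h2.trans h4.symm)
  have hQQs : ∀ i, SmallN (n+1) (QQ i) := by
    rintro i x ⟨hx, hxi⟩ y ⟨hy, hyi⟩ j hj
    rcases Nat.lt_succ_iff_lt_or_eq.1 hj with h | rfl
    · exact hν.Qs x hx y hy j h
    · rcases i with c | c
      · obtain ⟨h1, h2⟩ := ql x c hxi
        obtain ⟨h3, h4⟩ := ql y c hyi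
        rw [(hM2' x h1).1, (hM2' y h3).1, h2, h4]
      · obtain ⟨h1, h2⟩ := qr x c hxi
        obtain ⟨h3, h4⟩ := qr y c hyi
        exact hgd' x ⟨hx, h1⟩ y ⟨hy, h3⟩ (h2.trans h4.symm)
  have hPr : ∀ t, (PP (Sum.inr t)).Nonempty := by
    intro t
    obtain ⟨x, hx, hxt⟩ := hgs t
    exact ⟨x, hx.1, by simp [p, hx.2, hxt]⟩
  have hQr : ∀ t, (QQ (Sum.inr t)).Nonempty := by
    intro t
    obtain ⟨x, hx, hxt⟩ := hgs' t
    exact ⟨x, hx.1, by simp [q, hx.2, hxt]⟩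
  have hfr := fun t => fresh hX hX' hU hU' hFc hGc hFi hGi hFG (n+1) (ν.m+1)
    (hPPc (Sum.inr t)) (hQQc (Sum.inr t)) (hPr t) (hQr t) (hPPs _) (hQQs _)
  choose fr hfr1 hfr2 hfr3 hfr4 using hfr
  let ch : (T × T) ⊕ T → Nd T := fun i => match i with
    | Sum.inl c => ⟨PP (Sum.inl c), QQ (Sum.inl c), ν.Z, ν.a, ν.b, ν.m⟩
    | Sum.inr t => fr t
  have chP : ∀ i, (ch i).P = PP i := by
    rintro (c | c)
    · rfl
    · exact hfr2 c
  have chQ : ∀ i, (ch i).Q = QQ i := by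
    rintro (c | c)
    · rfl
    · exact hfr3 c
  have good : ∀ i, ((∃ t, i = Sum.inr t) ∨ ∃ z ∈ ν.Z, ν.a z ∈ ν.P ∧ i = Sum.inl (ν.a z n, ν.b z n)) →
      (ch i).Valid X X' F G (n+1) ∧ Child F G ν (ch i) := by
    rintro i (⟨t, rfl⟩ | ⟨z, hz, hzP, rfl⟩)
    · refine ⟨hfr1 t, Or.inr ⟨hfr4 t, ?_, ?_⟩⟩
      · refine disjoint_left.2 (fun x hx0 hxF => ?_)
        obtain ⟨hx, hxi⟩ := (chP (Sum.inr t)).le hx0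
        obtain ⟨z, hz, rfl⟩ := hν.hF ⟨hx, hxF⟩
        have := pM z hz hx
        rw [mem_preimage, this] at hxi
        cases hxi
      · refine disjoint_left.2 (fun x hx0 hxF => ?_)
        obtain ⟨hx, hxi⟩ := (chQ (Sum.inr t)).le hx0
        obtain ⟨z, hz, rfl⟩ := hν.hG ⟨hx, hxF⟩
        have := qM z hz hx
        rw [mem_preimage, this] at hxi
        cases hxi
    · have hzQ := (hν.hab z hz).1 hzP
      refine ⟨⟨hPPc _, hQQc _, ⟨_, hzP, pM z hz hzP⟩, ⟨_, hzQ, qM z hz hzQ⟩, hPPs _, hQQs _, hν.Zc,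
        hν.ha, hν.hb, ?_, ?_, hν.ia, hν.ib, ?_, ?_⟩, Or.inl ⟨rfl, rfl, rfl, rfl, z, hz,
          hzP, pM z hz hzP⟩⟩
      · intro y hy
        constructor
        · rintro ⟨h1, h2⟩
          have h3 := (hν.hab y hy).1 h1
          refine ⟨h3, ?_⟩
          rw [mem_preimage, qM y hy h3, ← pM y hy h1]; exact h2
        · rintro ⟨h1, h2⟩
          have h3 := (hν.hab y hy).2 h1
          refine ⟨h3, ?_⟩
          rw [mem_preimage, pM y hy h3, ← qM y hy h1]; exact h2
      · exact fun y hy h => hν.hmem y hy h.1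
      · exact fun x hx => hν.hF ⟨hx.1.1, hx.2⟩
      · exact fun x hx => hν.hG ⟨hx.1.1, hx.2⟩
  refine ⟨p, q, ch, hp, hq, fun i => ?_, fun x hx => ?_, fun y hy => ?_⟩
  · rw [chP, chQ]
    exact ⟨inter_subset_left, inter_subset_left, fun x hx => hx.2, fun x hx => hx.2⟩
  · refine ⟨by rw [chP]; exact ⟨hx, rfl⟩, good _ ?_⟩
    rcases hpx : p x with c | c
    · obtain ⟨h1, rfl⟩ := pl x c hpx
      obtain ⟨-, z, hz, hzw⟩ := hM2 x h1
      exact Or.inr ⟨z, hz.1, hz.2, by rw [hzw]⟩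
    · exact Or.inl ⟨c, rfl⟩
  · refine ⟨by rw [chQ]; exact ⟨hy, rfl⟩, good _ ?_⟩
    rcases hpx : q y with c | c
    · obtain ⟨h1, rfl⟩ := ql y c hpx
      obtain ⟨-, z, hz, hzw⟩ := hM2' y h1
      exact Or.inr ⟨z, hz.1, hz.2, by rw [hzw]⟩
    · exact Or.inl ⟨c, rfl⟩

end MK
end

section
set_option linter.unusedSectionVars false
set_option linter.unusedSimpArgs false
namespace MK

variable {T : Type u} [TopologicalSpace T] [DiscreteTopology T]

theorem smallN_eq {P : ℕ → Set (ℕ → T)} (hs : ∀ n, SmallN n (P n)) {x y : ℕ → T}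
    (hx : ∀ n, x ∈ P n) (hy : ∀ n, y ∈ P n) : x = y :=
  funext fun i => hs (i+1) x (hx _) y (hy _) i (Nat.lt_succ_self i)

/-- membership along a branch -/
theorem branch_mem {X X' : Set (ℕ → T)} {F G : ℕ → Set (ℕ → T)}
    (hXF : Xᶜ ⊆ ⋃ m, F m) (hXG : X'ᶜ ⊆ ⋃ m, G m) (N : ℕ → Nd T)
    (hN : ∀ n, (N n).Valid X X' F G n) (h0 : (N 0).m = 0) (hch : ∀ n, Child F G (N n) (N (n+1)))
    (hP : ∀ n, (N (n+1)).P ⊆ (N n).P) (hQ : ∀ n, (N (n+1)).Q ⊆ (N n).Q)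
    {x y : ℕ → T} (hx : ∀ n, x ∈ (N n).P) (hy : ∀ n, y ∈ (N n).Q) : x ∈ X ↔ y ∈ X' := by
  have hPa : Antitone (fun n => (N n).P) := antitone_nat_of_succ_le hP
  by_cases hA : ∃ n0, ∀ n, n0 ≤ n → (N (n+1)).Z = (N n).Z ∧ (N (n+1)).a = (N n).a ∧
      (N (n+1)).b = (N n).b ∧ (N (n+1)).m = (N n).m ∧ ∃ z ∈ (N n).Z, (N n).a z ∈ (N (n+1)).P
  · obtain ⟨n0, hA⟩ := hA
    have hc : ∀ n, n0 ≤ n → (N n).Z = (N n0).Z ∧ (N n).a = (N n0).a ∧ (N n).b = (N n0).b := by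
      intro n hn
      induction n, hn using Nat.le_induction with
      | base => exact ⟨rfl, rfl, rfl⟩
      | succ n hn ih =>
        obtain ⟨h1, h2, h3, -⟩ := hA n hn
        exact ⟨h1.trans ih.1, h2.trans ih.2.1, h3.trans ih.2.2⟩
    have hxc : x ∈ (N n0).a '' (N n0).Z := by
      rw [← ((hN n0).ha.isClosedMap _ (hN n0).Zc).closure_eq, mem_closure_iff]
      intro O hO hxO
      obtain ⟨n, hn, hnO⟩ := exists_cyl_subset hO hxO n0
      obtain ⟨-, -, -, -, z, hz, hza⟩ := hA n hn
      rw [(hc n hn).1] at hz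
      rw [(hc n hn).2.1] at hza
      refine ⟨_, hnO ?_, z, hz, rfl⟩
      intro i hi
      exact (hN (n+1)).Ps _ hza _ (hx _) i (hi.trans (Nat.lt_succ_self n))
    obtain ⟨z, hz, hzx⟩ := hxc
    have hbz : ∀ n, n0 ≤ n → (N n0).b z ∈ (N n).Q := by
      intro n hn
      have h1 := (hN n).hab z ((hc n hn).1 ▸ hz)
      rw [(hc n hn).2.1, (hc n hn).2.2, hzx] at h1
      exact h1.1 (hx n)
    have hyb : y = (N n0).b z := by
      funext i
      exact (hN (max n0 (i+1))).Qs _ (hy _) _ (hbz _ (le_max_left _ _)) i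
        (lt_of_lt_of_le (Nat.lt_succ_self i) (le_max_right _ _))
    have h2 := (hN n0).hmem z hz (hzx ▸ hx n0)
    rw [hzx, ← hyb] at h2
    exact h2
  · push Not at hA
    have hB : ∀ n0, ∃ n, n0 ≤ n ∧ (N (n+1)).m = (N n).m + 1 := by
      intro n0
      obtain ⟨n, hn, h⟩ := hA n0
      refine ⟨n, hn, ?_⟩
      rcases hch n with ⟨h1, h2, h3, h4, z, h5, h6⟩ | h'
      · exact absurd h6 (h h1 h2 h3 h4 z h5)
      · exact h'.1
    have hmm : ∀ n, (N n).m ≤ (N (n+1)).m ∧ (N (n+1)).m ≤ (N n).m + 1 := by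
      intro n
      rcases hch n with ⟨-, -, -, h4, -⟩ | h'
      · omega
      · omega
    have hmono : Monotone (fun n => (N n).m) := monotone_nat_of_le_succ fun n => (hmm n).1
    have hunb : ∀ m, ∃ n, m < (N n).m := by
      intro m
      induction m with
      | zero => obtain ⟨n, -, hn⟩ := hB 0; exact ⟨n+1, by omega⟩
      | succ m ih =>
        obtain ⟨n0, h0⟩ := ih
        obtain ⟨n, hn, h⟩ := hB n0
        have := hmono hn
        simp only at this
        exact ⟨n+1, by omega⟩
    have hall : ∀ m, x ∉ F m ∧ y ∉ G m := by
      intro m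
      classical
      have hf := Nat.find_spec (hunb m)
      have hmin := fun j => Nat.find_min (hunb m) (m := j)
      rcases hn : Nat.find (hunb m) with _ | n
      · rw [hn, h0] at hf; omega
      · rw [hn] at hf hmin
        have h1 := hmin n (Nat.lt_succ_self n)
        have h2 := hmm n
        have h3 : (N n).m = m := by omega
        rcases hch n with ⟨-, -, -, h4, -⟩ | ⟨-, h5, h6⟩
        · omega
        · rw [h3] at h5 h6
          exact ⟨disjoint_left.1 h5 (hx _), disjoint_left.1 h6 (hy _)⟩
    refine iff_of_true ?_ ?_
    · by_contra hcon
      obtain ⟨m, hm⟩ := mem_iUnion.1 (hXF hcon)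
      exact (hall m).1 hm
    · by_contra hcon
      obtain ⟨m, hm⟩ := mem_iUnion.1 (hXG hcon)
      exact (hall m).2 hm

theorem backforth0 {k : Cardinal.{u}} (hT : TCase k T) {X X' : Set (ℕ → T)}
    {F G : ℕ → Set (ℕ → T)} (hX : IsFsigmaDelta X)
    (hX' : IsFsigmaDelta X') (hU : Univ X) (hU' : Univ X')
    (hFc : ∀ m, IsClosed (F m)) (hGc : ∀ m, IsClosed (G m))
    (hFi : ∀ m, interior (F m) = ∅) (hGi : ∀ m, interior (G m) = ∅)
    (hFG : ∀ m, F m = ∅ ∨ G m = ∅)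
    (hXF : Xᶜ ⊆ ⋃ m, F m) (hXG : X'ᶜ ⊆ ⋃ m, G m) :
    ∃ h : (ℕ → T) ≃ₜ (ℕ → T), ∀ x, x ∈ X ↔ h x ∈ X' := by
  classical
  have hTne := hT.nonempty
  have hstep : ∀ (n : ℕ) (ν : Nd T), ∃ (p q : (ℕ → T) → (T × T) ⊕ T) (ch : (T × T) ⊕ T → Nd T),
      ν.Valid X X' F G n → Continuous p ∧ Continuous q ∧
      (∀ i, (ch i).P ⊆ ν.P ∧ (ch i).Q ⊆ ν.Q ∧ (∀ x ∈ (ch i).P, p x = i) ∧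
        ∀ y ∈ (ch i).Q, q y = i) ∧
      (∀ x ∈ ν.P, x ∈ (ch (p x)).P ∧ (ch (p x)).Valid X X' F G (n+1) ∧ Child F G ν (ch (p x))) ∧
      (∀ y ∈ ν.Q, y ∈ (ch (q y)).Q ∧ (ch (q y)).Valid X X' F G (n+1) ∧ Child F G ν (ch (q y))) := by
    intro n ν
    by_cases hν : ν.Valid X X' F G n
    · obtain ⟨p, q, ch, h⟩ := step_BF hT hX hX' hU hU' hFc hGc hFi hGi hFG n ν hν
      exact ⟨p, q, ch, fun _ => h⟩
    · exact ⟨fun _ => Sum.inr (Classical.arbitrary T), fun _ => Sum.inr (Classical.arbitrary T),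
        fun _ => ν, fun h => absurd h hν⟩
  choose p q ch hs using hstep
  obtain ⟨ν0, hν0, hP0, hQ0, hm0⟩ := fresh hX hX' hU hU' hFc hGc hFi hGi hFG 0 0
    (P := univ) (Q := univ) isClopen_univ isClopen_univ univ_nonempty univ_nonempty
    (fun _ _ _ _ i hi => absurd hi (Nat.not_lt_zero i))
    (fun _ _ _ _ i hi => absurd hi (Nat.not_lt_zero i))
  let pN : (ℕ → T) → ℕ → Nd T := fun x n => Nat.rec ν0 (fun n ν => ch n ν (p n ν x)) n
  let qN : (ℕ → T) → ℕ → Nd T := fun x n => Nat.rec ν0 (fun n ν => ch n ν (q n ν x)) n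
  have pNs : ∀ x n, pN x (n+1) = ch n (pN x n) (p n (pN x n) x) := fun _ _ => rfl
  have qNs : ∀ x n, qN x (n+1) = ch n (qN x n) (q n (qN x n) x) := fun _ _ => rfl
  have pV : ∀ x n, (pN x n).Valid X X' F G n ∧ x ∈ (pN x n).P := by
    intro x n
    induction n with
    | zero => exact ⟨hν0, hP0.ge (mem_univ x)⟩
    | succ n ih =>
      obtain ⟨-, -, -, h, -⟩ := hs n _ ih.1
      rw [pNs]
      exact ⟨(h x ih.2).2.1, (h x ih.2).1⟩
  have qV : ∀ x n, (qN x n).Valid X X' F G n ∧ x ∈ (qN x n).Q := by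
    intro x n
    induction n with
    | zero => exact ⟨hν0, hQ0.ge (mem_univ x)⟩
    | succ n ih =>
      obtain ⟨-, -, -, -, h⟩ := hs n _ ih.1
      rw [qNs]
      exact ⟨(h x ih.2).2.1, (h x ih.2).1⟩
  have pL : ∀ n x, ∀ᶠ y in 𝓝 x, pN y n = pN x n := by
    intro n x
    induction n with
    | zero => exact Eventually.of_forall fun _ => rfl
    | succ n ih =>
      filter_upwards [ih, ev_eq (hs n _ (pV x n).1).1 x] with y h1 h2
      rw [pNs, pNs, h1, h2]
  have qL : ∀ n x, ∀ᶠ y in 𝓝 x, qN y n = qN x n := by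
    intro n x
    induction n with
    | zero => exact Eventually.of_forall fun _ => rfl
    | succ n ih =>
      filter_upwards [ih, ev_eq (hs n _ (qV x n).1).2.1 x] with y h1 h2
      rw [qNs, qNs, h1, h2]
  have pPs : ∀ x n, (pN x (n+1)).P ⊆ (pN x n).P := fun x n =>
    ((hs n _ (pV x n).1).2.2.1 _).1
  have pQs : ∀ x n, (pN x (n+1)).Q ⊆ (pN x n).Q := fun x n =>
    ((hs n _ (pV x n).1).2.2.1 _).2.1
  have qPs : ∀ x n, (qN x (n+1)).P ⊆ (qN x n).P := fun x n =>
    ((hs n _ (qV x n).1).2.2.1 _).1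
  have hex : ∀ x, ∃ y, ∀ n, y ∈ (pN x n).Q := fun x =>
    nested_point _ (fun n => (pV x n).1.Qc.isClosed) (fun n => (pV x n).1.Qne) (pQs x)
      (fun n => (pV x n).1.Qs)
  have hex' : ∀ x, ∃ y, ∀ n, y ∈ (qN x n).P := fun x =>
    nested_point _ (fun n => (qV x n).1.Pc.isClosed) (fun n => (qV x n).1.Pne) (qPs x)
      (fun n => (qV x n).1.Ps)
  choose h hh using hex
  choose h' hh' using hex'
  have e1 : ∀ x n, qN (h x) n = pN x n := by
    intro x n
    induction n with
    | zero => rfl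
    | succ n ih =>
      rw [qNs, ih, pNs, ((hs n _ (pV x n).1).2.2.1 _).2.2.2 (h x) (hh x (n+1))]
  have e2 : ∀ x n, pN (h' x) n = qN x n := by
    intro x n
    induction n with
    | zero => rfl
    | succ n ih =>
      rw [pNs, ih, qNs, ((hs n _ (qV x n).1).2.2.1 _).2.2.1 (h' x) (hh' x (n+1))]
  have hc : Continuous h := by
    refine continuous_pi fun i => cont_of_ev fun x => ?_
    filter_upwards [pL (i+1) x] with y hy
    refine (pV x (i+1)).1.Qs _ ?_ _ (hh x (i+1)) i (Nat.lt_succ_self i)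
    rw [← hy]; exact hh y (i+1)
  have hc' : Continuous h' := by
    refine continuous_pi fun i => cont_of_ev fun x => ?_
    filter_upwards [qL (i+1) x] with y hy
    refine (qV x (i+1)).1.Ps _ ?_ _ (hh' x (i+1)) i (Nat.lt_succ_self i)
    rw [← hy]; exact hh' y (i+1)
  refine ⟨⟨⟨h, h', fun x => ?_, fun x => ?_⟩, hc, hc'⟩, fun x => ?_⟩
  · refine smallN_eq (fun n => (pV x n).1.Ps) (fun n => ?_) (fun n => (pV x n).2)
    rw [← e1]; exact hh' _ n
  · refine smallN_eq (fun n => (qV x n).1.Qs) (fun n => ?_) (fun n => (qV x n).2)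
    rw [← e2]; exact hh _ n
  · exact branch_mem hXF hXG (pN x) (fun n => (pV x n).1) hm0
      (fun n => ((hs n _ (pV x n).1).2.2.2.1 x (pV x n).2).2.2) (pPs x) (pQs x)
      (fun n => (pV x n).2) (hh x)

theorem backforth {k : Cardinal.{u}} (hT : TCase k T) {X X' : Set (ℕ → T)}
    {F G : ℕ → Set (ℕ → T)} (hX : IsFsigmaDelta X)
    (hX' : IsFsigmaDelta X') (hU : Univ X) (hU' : Univ X')
    (hFc : ∀ m, IsClosed (F m)) (hGc : ∀ m, IsClosed (G m))
    (hFi : ∀ m, interior (F m) = ∅) (hGi : ∀ m, interior (G m) = ∅)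
    (hXF : Xᶜ ⊆ ⋃ m, F m) (hXG : X'ᶜ ⊆ ⋃ m, G m) :
    ∃ h : (ℕ → T) ≃ₜ (ℕ → T), ∀ x, x ∈ X ↔ h x ∈ X' := by
  refine backforth0 hT (F := fun m => if m % 2 = 0 then F (m/2) else ∅)
    (G := fun m => if m % 2 = 0 then ∅ else G (m/2)) hX hX' hU hU' ?_ ?_ ?_ ?_ ?_ ?_ ?_
  · intro m; split_ifs
    exacts [hFc _, isClosed_empty]
  · intro m; split_ifs
    exacts [isClosed_empty, hGc _]
  · intro m; split_ifs
    exacts [hFi _, interior_empty]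
  · intro m; split_ifs
    exacts [interior_empty, hGi _]
  · intro m; split_ifs
    exacts [Or.inr rfl, Or.inl rfl]
  · refine hXF.trans (iUnion_subset fun m => ?_)
    refine subset_trans ?_ (subset_iUnion _ (2*m))
    simp
  · refine hXG.trans (iUnion_subset fun m => ?_)
    refine subset_trans ?_ (subset_iUnion _ (2*m+1))
    have : (2*m+1)/2 = m := by omega
    simp [this]

end MK
end

section
set_option linter.unusedSectionVars false
set_option linter.unusedSimpArgs false
namespace MK

variable {T : Type u} [TopologicalSpace T] [DiscreteTopology T]
variable {E : Type u} [TopologicalSpace E] [DiscreteTopology E]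

theorem fsig_open {Y : Type*} [TopologicalSpace Y] [TopologicalSpace.MetrizableSpace Y] {U : Set Y}
    (hU : IsOpen U) : IsFsigmaSet U := by
  letI := TopologicalSpace.metrizableSpaceMetric Y
  obtain ⟨F, h1, -, h2, -⟩ := hU.exists_iUnion_isClosed
  exact ⟨F, h1, h2.symm⟩

theorem fsig_union {Y : Type*} [TopologicalSpace Y] {U V : Set Y} (hU : IsFsigmaSet U)
    (hV : IsFsigmaSet V) : IsFsigmaSet (U ∪ V) := by
  obtain ⟨F, h1, rfl⟩ := hU
  obtain ⟨G, h2, rfl⟩ := hV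
  exact ⟨fun n => F n ∪ G n, fun n => (h1 n).union (h2 n), (iUnion_union_distrib _ _).symm⟩

theorem fsig_preimage {Y Z : Type*} [TopologicalSpace Y] [TopologicalSpace Z] {U : Set Y}
    (hU : IsFsigmaSet U) {f : Z → Y} (hf : Continuous f) : IsFsigmaSet (f ⁻¹' U) := by
  obtain ⟨F, h1, rfl⟩ := hU
  exact ⟨fun n => f ⁻¹' F n, fun n => (h1 n).preimage hf, preimage_iUnion⟩

theorem fsd_iInter {Y ι : Type*} [TopologicalSpace Y] [Countable ι] [Nonempty ι] {F : ι → Set Y}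
    (hF : ∀ i, IsFsigmaSet (F i)) : IsFsigmaDelta (⋂ i, F i) := by
  obtain ⟨g, hg⟩ := exists_surjective_nat ι
  exact ⟨fun n => F (g n), fun n => hF _, (hg.iInter_comp _).symm⟩

theorem fsd_inter {Y : Type*} [TopologicalSpace Y] {U V : Set Y} (hU : IsFsigmaDelta U)
    (hV : IsFsigmaDelta V) : IsFsigmaDelta (U ∩ V) := by
  obtain ⟨F, h1, rfl⟩ := hU
  obtain ⟨G, h2, rfl⟩ := hV
  have : (⋂ n, F n) ∩ ⋂ n, G n = ⋂ i : ℕ ⊕ ℕ, Sum.elim F G i := by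
    rw [iInter_sum]; rfl
  rw [this]
  refine fsd_iInter ?_
  rintro (n | n)
  exacts [h1 n, h2 n]

theorem fsd_gdelta {Y : Type*} [TopologicalSpace Y] [TopologicalSpace.MetrizableSpace Y] {U : Set Y}
    (hU : IsGδ U) : IsFsigmaDelta U := by
  obtain ⟨f, hf, rfl⟩ := isGδ_iff_eq_iInter_nat.1 hU
  exact fsd_iInter fun i => fsig_open (hf i)

theorem noiso (a b : E) (hab : a ≠ b) (z : ℕ → E) : ¬ IsOpen ({z} : Set (ℕ → E)) := by
  classical
  intro h
  obtain ⟨n, -, hn⟩ := exists_cyl_subset h (mem_singleton z) 0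
  have : ∃ e, e ≠ z n := by
    by_cases h : a = z n
    · exact ⟨b, fun hb => hab (h.trans hb.symm)⟩
    · exact ⟨a, h⟩
  obtain ⟨e, he⟩ := this
  have h1 : Function.update z n e ∈ PiNat.cylinder z n := by
    intro i hi
    rw [Function.update_of_ne (Nat.ne_of_lt hi)]
  have h2 := congrFun (hn h1) n
  rw [Function.update_self] at h2
  exact he h2

theorem exists_Phi {k : Cardinal.{u}} (hT : TCase k T) (hE : Cardinal.mk E = k) :
    ∃ Φ : (ℕ → E) → ℕ → T, IsEmbedding Φ ∧ DenseRange Φ ∧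
      ∀ e : (ℕ → T) → ℕ → E, IsClosedEmbedding e → IsClosedEmbedding (Φ ∘ e) := by
  rcases hT with ⟨hk, h2⟩ | ⟨hk, hTk⟩
  · have hEc : Countable E := Cardinal.mk_le_aleph0_iff.1 (by rw [hE, hk])
    have hEi : Infinite E := Cardinal.infinite_iff.2 (by rw [hE, hk])
    obtain ⟨a, b, hab⟩ := exists_pair_ne E
    have hc1 : ∀ s : Σ n, (Fin n → E), IsClopen {z : ℕ → E | ∀ i : Fin s.1, z i = s.2 i} := by
      rintro ⟨n, f⟩
      have : {z : ℕ → E | ∀ i : Fin n, z i = f i} =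
          ⋂ i : Fin n, (fun z : ℕ → E => z i) ⁻¹' {f i} := by
        ext z; simp
      show IsClopen {z : ℕ → E | ∀ i : Fin n, z i = f i}
      rw [this]
      exact isClopen_iInter_of_finite fun i => (isClopen_discrete _).preimage (continuous_apply _)
    have hc2 : ∀ (z : ℕ → E) O, IsOpen O → z ∈ O → ∃ s : Σ n, (Fin n → E),
        z ∈ {z : ℕ → E | ∀ i : Fin s.1, z i = s.2 i} ∧
        {z : ℕ → E | ∀ i : Fin s.1, z i = s.2 i} ⊆ O := by
      intro z O hO hz
      obtain ⟨n, -, hn⟩ := exists_cyl_subset hO hz 0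
      refine ⟨⟨n, fun i => z i⟩, fun i => rfl, fun y hy => hn fun i hi => hy ⟨i, hi⟩⟩
    obtain ⟨Φ, h1, h3⟩ := dense_omega h2 _ hc1 hc2 (noiso a b hab)
    refine ⟨Φ, h1, h3, fun e he => ?_⟩
    have : Finite T := by
      rw [← Cardinal.lt_aleph0_iff_finite, h2]; exact Cardinal.ofNat_lt_aleph0
    exact (h1.continuous.comp he.continuous).isClosedEmbedding (h1.injective.comp he.injective)
  · obtain ⟨ε⟩ := Cardinal.eq.1 (hE.trans hTk.symm)
    let h : (ℕ → E) ≃ₜ (ℕ → T) := Homeomorph.piCongrRight fun _ =>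
      ⟨ε, continuous_of_discreteTopology, continuous_of_discreteTopology⟩
    exact ⟨h, h.isEmbedding, h.surjective.denseRange, fun e he => h.isClosedEmbedding.comp he⟩

theorem exists_Psi {k : Cardinal.{u}} (hT : TCase k T) :
    Nonempty (((ℕ → Bool) × (ℕ → T)) ≃ₜ (ℕ → T)) := by
  rcases hT with ⟨hk, h2⟩ | ⟨hk, hTk⟩
  · have : Nonempty (Bool ≃ T) := by
      rw [← Cardinal.lift_mk_eq']
      simp [h2]
    obtain ⟨ε⟩ := this
    let h : (ℕ → Bool) ≃ₜ (ℕ → T) := Homeomorph.piCongrRight fun _ =>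
      ⟨ε, continuous_of_discreteTopology, continuous_of_discreteTopology⟩
    exact ⟨((h.prodCongr (Homeomorph.refl _)).trans
      Homeomorph.sumArrowHomeomorphProdArrow.symm).trans
      (Homeomorph.piCongrLeft (Y := fun _ => T) Equiv.natSumNatEquivNat)⟩
  · have : Nonempty ((Bool × T) ≃ T) := by
      rw [← Cardinal.lift_mk_eq']
      simp only [Cardinal.mk_prod, Cardinal.lift_id, hTk]
      simp only [Cardinal.mk_bool, Cardinal.lift_ofNat, Cardinal.lift_mul, Cardinal.lift_lift, Cardinal.lift_id, Cardinal.lift_uzero]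
      exact Cardinal.mul_eq_right hk.le ((Cardinal.ofNat_lt_aleph0 (n := 2)).le.trans hk.le) two_ne_zero
    obtain ⟨ε⟩ := this
    refine ⟨⟨⟨fun p i => ε (p.1 i, p.2 i), fun y => (fun i => (ε.symm (y i)).1,
      fun i => (ε.symm (y i)).2), fun p => ?_, fun y => ?_⟩, ?_, ?_⟩⟩
    · simp
    · simp
    · refine continuous_pi fun i => (continuous_of_discreteTopology (f := ε)).comp ?_
      exact ((continuous_apply i).comp continuous_fst).prodMk
        ((continuous_apply i).comp continuous_snd)
    · refine (continuous_pi fun i => ?_).prodMk (continuous_pi fun i => ?_)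
      · exact (continuous_of_discreteTopology (f := fun t => (ε.symm t).1)).comp (continuous_apply i)
      · exact (continuous_of_discreteTopology (f := fun t => (ε.symm t).2)).comp (continuous_apply i)

theorem exists_j : ∃ j : ℚ → ℕ → Bool, IsEmbedding j ∧ DenseRange j := by
  have hirr : ∀ a x : ℚ, (a : ℝ) + √2 ≠ x := by
    intro a x h
    have := irrational_sqrt_two
    exact this ⟨x - a, by push_cast; linarith⟩
  refine dense_omega (by simp) (Z := ℚ) (ι := ℚ × ℚ)
    (fun p => {x : ℚ | (p.1 : ℝ) + √2 < x ∧ (x : ℝ) < p.2 + √2}) ?_ ?_ ?_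
  · rintro ⟨a, b⟩
    have hc : Continuous (fun x : ℚ => (x : ℝ)) := Rat.continuous_coe_real
    refine ⟨?_, (isOpen_lt continuous_const hc).inter (isOpen_lt hc continuous_const)⟩
    have : {x : ℚ | (a : ℝ) + √2 < x ∧ (x : ℝ) < b + √2} =
        {x : ℚ | (a : ℝ) + √2 ≤ x ∧ (x : ℝ) ≤ b + √2} := by
      ext x
      exact ⟨fun h => ⟨h.1.le, h.2.le⟩, fun h => ⟨lt_of_le_of_ne h.1 (hirr _ _),
        lt_of_le_of_ne h.2 (hirr _ _).symm⟩⟩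
    show IsClosed {x : ℚ | (a : ℝ) + √2 < x ∧ (x : ℝ) < b + √2}
    rw [this]
    exact (isClosed_le continuous_const hc).inter (isClosed_le hc continuous_const)
  · intro z O hO hz
    obtain ⟨ε, hε, hb⟩ := Metric.isOpen_iff.1 hO z hz
    obtain ⟨a, ha1, ha2⟩ := exists_rat_btwn (show (z : ℝ) - ε - √2 < z - √2 by linarith)
    obtain ⟨b, hb1, hb2⟩ := exists_rat_btwn (show (z : ℝ) - √2 < z + ε - √2 by linarith)
    refine ⟨(a, b), ⟨by simp only; linarith, by simp only; linarith⟩, fun x hx => hb ?_⟩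
    obtain ⟨h1, h2⟩ := hx
    simp only at h1 h2
    rw [Metric.mem_ball, Rat.dist_eq, abs_lt]
    constructor <;> linarith
  · intro z h
    obtain ⟨ε, hε, hb⟩ := Metric.isOpen_iff.1 h z rfl
    obtain ⟨a, ha1, ha2⟩ := exists_rat_btwn (show (z : ℝ) < z + ε by linarith)
    have : a = z := hb (by rw [Metric.mem_ball, Rat.dist_eq, abs_lt]; constructor <;> linarith)
    rw [this] at ha1
    exact lt_irrefl _ ha1

theorem R0_dense (b0 : E) : Dense (R0 b0) := by
  intro z
  rw [mem_closure_iff]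
  intro O hO hz
  obtain ⟨n, -, hn⟩ := exists_cyl_subset hO hz 0
  refine ⟨fun i => if i < n then z i else b0, hn fun i hi => if_pos hi, fun r => ?_⟩
  filter_upwards [eventually_ge_atTop n] with j hj
  exact if_neg (not_lt.2 (hj.trans (Nat.right_le_pair r j)))

theorem R0_compl_dense (b0 b1 : E) (hb : b0 ≠ b1) : Dense (R0 b0)ᶜ := by
  intro z
  rw [mem_closure_iff]
  intro O hO hz
  obtain ⟨n, -, hn⟩ := exists_cyl_subset hO hz 0
  refine ⟨fun i => if i < n then z i else b1, hn fun i hi => if_pos hi, fun hr => ?_⟩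
  obtain ⟨j, h1, h2⟩ := ((hr 0).and (eventually_ge_atTop n)).exists
  simp only [if_neg (not_lt.2 (h2.trans (Nat.right_le_pair 0 j)))] at h1
  exact hb h1.symm

theorem fsd_image {Φ : (ℕ → E) → ℕ → T} (hΦ : IsEmbedding Φ) (b0 : E) :
    IsFsigmaDelta (Φ '' R0 b0) := by
  have hg : IsGδ (range Φ) := by
    refine gdelta_complete ?_ Φ hΦ
    exact (inferInstance : TopologicalSpace.IsCompletelyMetrizableSpace (ℕ → E)).complete
  have hC : ∀ n N, IsClosed {z : ℕ → E | ∀ j ≥ N, z (Nat.pair n j) = b0} := by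
    intro n N
    have : {z : ℕ → E | ∀ j ≥ N, z (Nat.pair n j) = b0} =
      ⋂ j, ⋂ (_ : j ≥ N), (fun z : ℕ → E => z (Nat.pair n j)) ⁻¹' {b0} := by
      ext z; simp
    rw [this]
    exact isClosed_iInter fun j => isClosed_iInter fun _ =>
      (isClosed_discrete _).preimage (continuous_apply _)
  have hK : ∀ n N, ∃ K, IsClosed K ∧ Φ ⁻¹' K = {z : ℕ → E | ∀ j ≥ N, z (Nat.pair n j) = b0} :=
    fun n N => hΦ.isInducing.isClosed_iff.1 (hC n N)
  choose K hKc hK using hK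
  have : Φ '' R0 b0 = range Φ ∩ ⋂ n, ⋃ N, K n N := by
    have key : ∀ z, z ∈ R0 b0 ↔ Φ z ∈ ⋂ n, ⋃ N, K n N := by
      intro z
      simp only [mem_iInter, mem_iUnion]
      refine forall_congr' fun n => ?_
      rw [eventually_atTop]
      refine exists_congr fun N => ?_
      rw [← mem_preimage, hK]; rfl
    ext y
    constructor
    · rintro ⟨z, hz, rfl⟩
      exact ⟨⟨z, rfl⟩, (key z).1 hz⟩
    · rintro ⟨⟨z, rfl⟩, hz⟩
      exact ⟨z, (key z).2 hz, rfl⟩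
  rw [this]
  exact fsd_inter (fsd_gdelta hg) (fsd_iInter fun n => ⟨K n, hKc n, rfl⟩)

theorem exists_e (t0 : T) (b0 : E) (ι : T → E) (hι : Function.Injective ι) (h0 : ι t0 = b0)
    (w : ℕ → E) (L : ℕ) : ∃ e : (ℕ → T) → ℕ → E, IsClosedEmbedding e ∧
      (∀ z, e z ∈ PiNat.cylinder w L) ∧ ∀ z, e z ∈ R0 b0 ↔ z ∈ R0 t0 := by
  classical
  have : Nonempty T := ⟨t0⟩
  let e : (ℕ → T) → ℕ → E := fun z m => if (Nat.unpair m).2 < L then w m else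
    ι (z (Nat.pair (Nat.unpair m).1 ((Nat.unpair m).2 - L)))
  let l : (ℕ → E) → ℕ → T := fun y m =>
    Function.invFun ι (y (Nat.pair (Nat.unpair m).1 ((Nat.unpair m).2 + L)))
  have hec : Continuous e := by
    refine continuous_pi fun m => ?_
    by_cases h : (Nat.unpair m).2 < L
    · simp only [e, if_pos h]; exact continuous_const
    · simp only [e, if_neg h]
      exact (continuous_of_discreteTopology (f := ι)).comp (continuous_apply _)
  have hlc : Continuous l := continuous_pi fun m =>
    (continuous_of_discreteTopology (f := Function.invFun ι)).comp (continuous_apply _)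
  have hle : Function.LeftInverse l e := by
    intro z
    funext m
    simp only [l, e, Nat.unpair_pair]
    rw [if_neg (by omega), Nat.add_sub_cancel, Nat.pair_unpair]
    exact Function.leftInverse_invFun hι _
  refine ⟨e, hle.isClosedEmbedding hlc hec, fun z m hm => ?_, fun z => ?_⟩
  · exact if_pos (lt_of_le_of_lt (Nat.unpair_right_le m) hm)
  · refine forall_congr' fun n => ?_
    have hev : ∀ j, e z (Nat.pair n (j + L)) = ι (z (Nat.pair n j)) := by
      intro j
      simp only [e, Nat.unpair_pair]
      rw [if_neg (by omega), Nat.add_sub_cancel]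
    have hsh : (∀ᶠ j in atTop, e z (Nat.pair n j) = b0) ↔
        ∀ᶠ j in atTop, e z (Nat.pair n (j + L)) = b0 := by
      conv_lhs => rw [← map_add_atTop_eq_nat L]
      rfl
    rw [hsh]
    simp only [hev, ← h0, hι.eq_iff]

end MK
end

section
set_option linter.unusedSectionVars false
set_option linter.unusedSimpArgs false
namespace MK

variable {T : Type u} [TopologicalSpace T] [DiscreteTopology T]
variable {E : Type u} [TopologicalSpace E] [DiscreteTopology E]

theorem TCase.two {k : Cardinal.{u}} (hT : TCase k T) : ∃ a b : T, a ≠ b := by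
  have : (1 : Cardinal) < Cardinal.mk T := by
    rcases hT with ⟨-, h⟩ | ⟨h, h'⟩
    · rw [h]; exact Cardinal.one_lt_two
    · rw [h']; exact Cardinal.one_lt_aleph0.trans h
  rw [Cardinal.one_lt_iff_nontrivial] at this
  exact exists_pair_ne T

theorem TCase.inj {k : Cardinal.{u}} (hk : Cardinal.aleph0 ≤ k) (hT : TCase k T)
    (hE : Cardinal.mk E = k) (t0 : T) (b0 : E) :
    ∃ ι : T → E, Function.Injective ι ∧ ι t0 = b0 := by
  classical
  have : Cardinal.mk T ≤ Cardinal.mk E := by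
    rw [hE]
    rcases hT with ⟨-, h⟩ | ⟨h, h'⟩
    · rw [h]; exact (Cardinal.ofNat_lt_aleph0 (n := 2)).le.trans hk
    · rw [h']
  obtain ⟨f⟩ := Cardinal.le_def _ _ |>.1 this
  exact ⟨Equiv.swap (f t0) b0 ∘ f, (Equiv.injective _).comp f.injective, by simp⟩

theorem model {k : Cardinal.{u}} (hk : Cardinal.aleph0 ≤ k) (hT : TCase k T)
    (hE : Cardinal.mk E = k) (b0 : E) :
    ∃ (A Y : Set (ℕ → T)) (G : ℕ → Set (ℕ → T)), Dense A ∧ Nonempty (↥A ≃ₜ ↥(R0 b0)) ∧ Dense Y ∧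
      Nonempty (↥Y ≃ₜ ℚ × ↥(Aᶜ)) ∧ IsFsigmaDelta Yᶜ ∧ Univ Yᶜ ∧ (∀ n, IsClosed (G n)) ∧
      (∀ n, interior (G n) = ∅) ∧ Y ⊆ ⋃ n, G n := by
  obtain ⟨Φ, hΦ, hΦd, hΦc⟩ := exists_Phi hT hE
  obtain ⟨Ψ⟩ := exists_Psi hT
  obtain ⟨j, hj, hjd⟩ := exists_j
  obtain ⟨t0, t1, h01⟩ := hT.two
  obtain ⟨ι, hι, hι0⟩ := hT.inj hk hE t0 b0
  have hb1 : b0 ≠ ι t1 := fun h => h01 (hι (hι0.trans h))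
  let A : Set (ℕ → T) := Φ '' R0 b0
  have hAd : Dense A := hΦd.dense_image hΦ.continuous (R0_dense b0)
  have hAcd : Dense Aᶜ := by
    refine (hΦd.dense_image hΦ.continuous (R0_compl_dense b0 _ hb1)).mono ?_
    rintro _ ⟨z, hz, rfl⟩ ⟨y, hy, hyz⟩
    exact hz (hΦ.injective hyz ▸ hy)
  have hAF : IsFsigmaDelta A := fsd_image hΦ b0
  let g : ℚ × ↥(Aᶜ) → ℕ → T := fun p => Ψ (j p.1, p.2.1)
  have hg : IsEmbedding g := Ψ.isEmbedding.comp (hj.prodMap IsEmbedding.subtypeVal)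
  have hgY : ∀ c d, Ψ (c, d) ∈ range g ↔ c ∈ range j ∧ d ∉ A := by
    intro c d
    constructor
    · rintro ⟨⟨q, a⟩, h⟩
      have := Ψ.injective h
      simp only [Prod.mk.injEq] at this
      exact ⟨⟨q, this.1⟩, this.2 ▸ a.2⟩
    · rintro ⟨⟨q, rfl⟩, hd⟩
      exact ⟨(q, ⟨d, hd⟩), rfl⟩
  have hgd : DenseRange g := by
    have h1 : DenseRange (Prod.map j (Subtype.val : ↥(Aᶜ) → ℕ → T)) :=
      hjd.prodMap hAcd.denseRange_val
    exact Ψ.surjective.denseRange.comp h1 Ψ.continuous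
  let c : (ℕ → T) → ℕ → Bool := fun x => (Ψ.symm x).1
  let d : (ℕ → T) → ℕ → T := fun x => (Ψ.symm x).2
  have hc : Continuous c := continuous_fst.comp Ψ.symm.continuous
  have hd : Continuous d := continuous_snd.comp Ψ.symm.continuous
  have hcd : ∀ x, Ψ (c x, d x) = x := fun x => Ψ.apply_symm_apply x
  have hco : IsOpenMap c := isOpenMap_fst.comp Ψ.symm.isOpenMap
  have hjint : ∀ q, interior {j q} = (∅ : Set (ℕ → Bool)) := by
    intro q
    by_contra hne
    rcases (subset_singleton_iff_eq.1 (interior_subset (s := {j q}))) with h | h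
    · exact hne h
    · exact noiso true false (by decide) (j q) (h ▸ isOpen_interior)
  obtain ⟨s, hs⟩ := exists_surjective_nat ℚ
  refine ⟨A, range g, fun n => c ⁻¹' {j (s n)}, hAd, ⟨(hΦ.homeomorphImage _).symm⟩, hgd,
    ⟨hg.toHomeomorph.symm⟩, ?_, ?_, fun n => isClosed_singleton.preimage hc, ?_, ?_⟩
  · obtain ⟨S, hS, hSA⟩ := hAF
    have : (range g)ᶜ = ⋂ p : ℚ × ℕ, (c ⁻¹' {j p.1})ᶜ ∪ d ⁻¹' S p.2 := by
      ext x
      rw [mem_compl_iff, ← hcd x, hgY, hSA]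
      simp only [mem_iInter, mem_union, mem_compl_iff, mem_preimage, mem_singleton_iff, hcd,
        Prod.forall, mem_range]
      constructor
      · intro h q n
        by_cases hq : c x = j q
        · right
          by_contra hn
          exact h ⟨⟨q, hq.symm⟩, fun h' => hn (h' n)⟩
        · exact Or.inl hq
      · rintro h ⟨⟨q, hq⟩, hn⟩
        exact hn fun n => (h q n).resolve_left fun h' => h' hq.symm
    rw [this]
    exact fsd_iInter fun p => fsig_union
      (fsig_open (isClosed_singleton.preimage hc).isOpen_compl) (fsig_preimage (hS _) hd)
  · refine univ_of_R0 t0 t1 h01 _ fun Q hQ hQne => ?_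
    have hQo : IsOpen (Ψ ⁻¹' Q) := hQ.isOpen.preimage Ψ.continuous
    obtain ⟨x, hx⟩ := hQne
    have hx' : (c x, d x) ∈ Ψ ⁻¹' Q := by rw [mem_preimage, hcd]; exact hx
    obtain ⟨U, V, hU, hV, hcU, hdV, hUV⟩ := isOpen_prod_iff.1 hQo _ _ hx'
    obtain ⟨q, hq⟩ := hjd.exists_mem_open hU ⟨_, hcU⟩
    obtain ⟨w, hw⟩ := hΦd.exists_mem_open hV ⟨_, hdV⟩
    obtain ⟨L, -, hL⟩ := exists_cyl_subset (hV.preimage hΦ.continuous) hw 0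
    obtain ⟨e, he, heL, heR⟩ := exists_e t0 b0 ι hι hι0 w L
    have hpair : IsClosedEmbedding (fun y : ℕ → T => (j q, y)) :=
      Function.LeftInverse.isClosedEmbedding (f := Prod.snd) (fun _ => rfl) continuous_snd
        (by fun_prop)
    refine ⟨fun z => Ψ (j q, Φ (e z)),
      (Ψ.isClosedEmbedding.comp hpair).comp (hΦc e he), ?_, ?_⟩
    · rintro _ ⟨z, rfl⟩
      exact hUV ⟨hq, hL (heL z)⟩
    · ext z
      rw [mem_preimage, mem_compl_iff, hgY, ← heR]
      have : Φ (e z) ∈ A ↔ e z ∈ R0 b0 := hΦ.injective.mem_set_image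
      rw [← this]
      simp
  · intro n
    rw [← hco.preimage_interior_eq_interior_preimage hc, hjint, preimage_empty]
  · rintro _ ⟨⟨q, a⟩, rfl⟩
    obtain ⟨n, rfl⟩ := hs q
    refine mem_iUnion.2 ⟨n, ?_⟩
    show (Ψ.symm (Ψ (j (s n), a.1))).1 = j (s n)
    rw [Ψ.symm_apply_apply]

theorem rows_homeo (b0 : E) :
    Nonempty (↥(R0 b0) ≃ₜ (ℕ → {x : ℕ → E // ∀ᶠ n in Filter.atTop, x n = b0})) := by
  let f : ↥(R0 b0) → (ℕ → {x : ℕ → E // ∀ᶠ n in Filter.atTop, x n = b0}) :=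
    fun z n => ⟨fun j => z.1 (Nat.pair n j), z.2 n⟩
  let h : (ℕ → {x : ℕ → E // ∀ᶠ n in Filter.atTop, x n = b0}) → ↥(R0 b0) :=
    fun y => ⟨fun m => (y (Nat.unpair m).1).1 (Nat.unpair m).2, fun n => by
      simpa only [Nat.unpair_pair] using (y n).2⟩
  refine ⟨⟨⟨f, h, fun z => ?_, fun y => ?_⟩, ?_, ?_⟩⟩
  · apply Subtype.ext
    funext m
    simp only [f, h, Nat.pair_unpair]
  · funext n
    apply Subtype.ext
    funext m
    simp only [f, h, Nat.unpair_pair]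
  · refine continuous_pi fun n => Continuous.subtype_mk ?_ _
    exact continuous_pi fun m => (continuous_apply _).comp continuous_subtype_val
  · refine Continuous.subtype_mk (continuous_pi fun m => ?_) _
    exact (continuous_apply (Nat.unpair m).2).comp
      (continuous_subtype_val.comp (continuous_apply (Nat.unpair m).1))

def qb (k : Cardinal.{u}) : QBase k := Sum.inr PUnit.unit

theorem qkOmega_homeo (k : Cardinal.{u}) : Nonempty (↥(R0 (qb k)) ≃ₜ QkOmega k) :=
  rows_homeo (qb k)

theorem tcase_star (k : Cardinal.{u}) (hk : Cardinal.aleph0 ≤ k) : TCase k (StarT k) := by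
  by_cases h : k = Cardinal.aleph0
  · refine Or.inl ⟨h, ?_⟩
    rw [StarT, if_pos h]
    simp
  · refine Or.inr ⟨lt_of_le_of_ne hk (Ne.symm h), ?_⟩
    rw [StarT, if_neg h]
    exact Cardinal.mk_out k

theorem mk_qbase (k : Cardinal.{u}) (hk : Cardinal.aleph0 ≤ k) : Cardinal.mk (QBase k) = k := by
  have h1 : Cardinal.mk (DiscT k) = k := Cardinal.mk_out k
  have : Cardinal.mk (QBase k) = Cardinal.mk (DiscT k) + 1 := by
    show Cardinal.mk (DiscT k ⊕ PUnit.{u+1}) = _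
    simp
  rw [this, h1, Cardinal.add_one_eq hk]

theorem final (k : Cardinal.{u}) (hk : Cardinal.aleph0 ≤ k)
    (X : Type u) [TopologicalSpace X]
    (habs : AbsFsigmaDelta X) (hind : StronglyZeroDim X)
    (hnw : NowhereSLWplusGDS X k)
    (hcomp : ∃ D : Set X, Dense D ∧ CompletelyMetrizable ↥D)
    (hw : topWeight X = k) :
    IsMII k X := by
  have hT := tcase_star k hk
  have hmet := habs.1
  have hne : Nonempty X := by
    by_contra hcon
    rw [not_nonempty_iff] at hcon
    have h1 : topWeight X ≤ Cardinal.mk (Set (Set X)) :=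
      (ciInf_le' _ (⟨_, TopologicalSpace.isTopologicalBasis_opens⟩ :
        {B : Set (Set X) // TopologicalSpace.IsTopologicalBasis B})).trans
        ((Cardinal.mk_set_le _).trans (Cardinal.mk_le_of_injective (f := fun s : Set X => {s})
          (fun _ _ h => singleton_injective h)))
    have h2 : Cardinal.mk (Set (Set X)) < Cardinal.aleph0 := Cardinal.lt_aleph0_of_finite _
    rw [hw] at h1
    exact absurd (hk.trans h1) (not_le.2 h2)
  have hns : ∀ U : Set X, IsOpen U → U.Nonempty → ¬ WeightLT ↥U k := by
    intro U hU hUne hUw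
    refine hnw U hU hUne ⟨univ, ∅, union_empty _, ⟨fun _ => univ, iUnion_const _, fun n x => ?_⟩, ?_⟩
    · refine ⟨univ, univ_mem, ?_⟩
      exact weightLT_of_inducing (f := fun x => x.1.1.1)
        ((IsInducing.subtypeVal.comp IsInducing.subtypeVal).comp IsInducing.subtypeVal) hUw
    · refine ⟨inferInstance, fun Y _ _ f hf => ⟨fun _ => ∅, fun _ => .empty, ?_⟩⟩
      simp
  obtain ⟨e, he, hed⟩ := embed_X hT hind hw hns
  obtain ⟨t0, t1, h01⟩ := hT.two
  have hF : IsFsigmaDelta (range e) := habs.2 _ e he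
  have hU : Univ (range e) := by
    obtain ⟨F, hF1, hF2, hF3⟩ := fsd_data hF
    exact univ_of_R0 t0 t1 h01 _ fun Q hQ hQne =>
      lemmaH hT t0 hF1 hF2 hF3 Q hQ (nonsmall_X hnw e he hed hQ hQne)
  obtain ⟨A, Y, G, hA1, ⟨hA2⟩, hY1, ⟨hY2⟩, hY3, hY4, hG1, hG2, hG3⟩ :=
    model hk hT (mk_qbase k hk) (qb k)
  obtain ⟨D, hD, hDc⟩ := hcomp
  have hDe : IsEmbedding (fun x : D => e x.1) := he.comp IsEmbedding.subtypeVal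
  have hDg : IsGδ (range fun x : D => e x.1) := gdelta_complete hDc _ hDe
  have hDd : Dense (range fun x : D => e x.1) := hed.comp hD.denseRange_val he.continuous
  obtain ⟨O, hO, hOe⟩ := isGδ_iff_eq_iInter_nat.1 hDg
  have hsub : (range e)ᶜ ⊆ ⋃ n, (O n)ᶜ := by
    rw [← compl_iInter, ← hOe]
    refine compl_subset_compl.2 ?_
    rintro _ ⟨x, rfl⟩
    exact ⟨x.1, rfl⟩
  obtain ⟨h, hh⟩ := backforth hT hF hY3 hU hY4 (fun n => (hO n).isClosed_compl) hG1
    (fun n => interior_eq_empty_iff_dense_compl.2 (by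
      rw [compl_compl]
      refine hDd.mono ?_
      rw [hOe]; exact iInter_subset _ n)) hG2 hsub (by rwa [compl_compl])
  obtain ⟨φ⟩ := qkOmega_homeo k
  refine ⟨Y, hY1, ⟨A, hA1, ⟨hA2.trans φ⟩, ⟨hY2⟩⟩, ⟨he.toHomeomorph.trans ?_⟩⟩
  exact h.subtype hh

end MK
end

/-- Theorem `t-mk2`: a topological characterization of `M^{II}_k`. -/
theorem stmt_18 (k : Cardinal.{u}) (hk : Cardinal.aleph0 ≤ k)
    (X : Type u) [TopologicalSpace X]
    (habs : AbsFsigmaDelta X) (hind : StronglyZeroDim X)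
    (hnw : NowhereSLWplusGDS X k)
    (hcomp : ∃ D : Set X, Dense D ∧ CompletelyMetrizable ↥D)
    (hw : topWeight X = k) :
    IsMII k X := by
  exact MK.final k hk X habs hind hnw hcomp hw
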